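/- arXiv:2111.12827 — 4 statements merged into one kernel-verified Lean document; each statement's English description precedes it below -/
import Mathlib

section
/- Let Θ' ⊆ Θ be G-stable lattices in Π such that the inclusion is saturated, i.e. Θ' is not contained in ϖΘ, and such that the O[G]-module Θ/Θ' has composition length n. Then the annihilator of Θ/Θ' in O is exactly the ideal ϖⁿO. -/
set_option synthInstance.maxHeartbeats 1000000
set_option maxHeartbeats 1000000

section Banach

variable (E : Type*) [NormedField E] [CompleteSpace E] [IsUltrametricDist E]

/-- The ring of integers `O` of a nonarchimedean field: elements of norm at most `1`. -/
def intRing : Subring E where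
  carrier := {x | ‖x‖ ≤ 1}
  one_mem' := by simp
  mul_mem' := by
    intro a b ha hb
    calc ‖a * b‖ = ‖a‖ * ‖b‖ := norm_mul a b
    _ ≤ 1 * 1 := mul_le_mul ha hb (norm_nonneg b) zero_le_one
    _ = 1 := one_mul 1
  add_mem' := by
    intro a b ha hb
    exact le_trans (IsUltrametricDist.norm_add_le_max a b) (max_le ha hb)
  zero_mem' := by simp
  neg_mem' := by intro a ha; simpa using ha

variable (V : Type*) [NormedAddCommGroup V] [NormedSpace E V]

/-- Scalar multiplication by `c ∈ E` as an `O`-linear endomorphism of `V`. -/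
def scalarMap (c : E) : V →ₗ[intRing E] V where
  toFun v := c • v
  map_add' := smul_add c
  map_smul' := by
    intro o v
    show c • ((o : E) • v) = (o : E) • (c • v)
    exact smul_comm c (o : E) v

/-- A lattice in an `E`-Banach space: an open bounded `O`-submodule. -/
def IsLat (Θ : Submodule (intRing E) V) : Prop :=
  IsOpen (Θ : Set V) ∧ Bornology.IsBounded (Θ : Set V)

variable (G : Type*) [Group G]

/-- `G`-stability of an `O`-submodule under an action `ρ` of `G` on `V`. -/
def GStable (ρ : G →* (V ≃L[E] V)) (Θ : Submodule (intRing E) V) : Prop :=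
  ∀ g : G, ∀ x ∈ Θ, ρ g x ∈ Θ

/-- The standing residual hypothesis: there is a `G`-stable lattice `Θ₀` such that
`Θ₀/ϖΘ₀` has composition length two with two non-isomorphic simple Jordan–Hölder factors
(as a `k[G] = O/ϖ[G]`-module, i.e. with respect to `G`-stable `O`-submodules). -/
def ResidualLengthTwo (ϖ : E) (ρ : G →* (V ≃L[E] V)) : Prop :=
  ∃ Θ₀ : Submodule (intRing E) V, IsLat E V Θ₀ ∧
    ∃ hst₀ : GStable E V G ρ Θ₀,
      ∃ M : Submodule (intRing E) V,
        ∃ hstM : GStable E V G ρ M,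
          Θ₀.map (scalarMap E V ϖ) < M ∧ M < Θ₀ ∧
          (∀ N : Submodule (intRing E) V, GStable E V G ρ N →
            Θ₀.map (scalarMap E V ϖ) ≤ N → N ≤ M → N = Θ₀.map (scalarMap E V ϖ) ∨ N = M) ∧
          (∀ N : Submodule (intRing E) V, GStable E V G ρ N →
            M ≤ N → N ≤ Θ₀ → N = M ∨ N = Θ₀) ∧
          -- the two Jordan–Hölder factors `Θ₀/M` and `M/ϖΘ₀` are not isomorphic
          ¬ ∃ e : (Θ₀ ⧸ M.comap Θ₀.subtype) ≃ₗ[intRing E]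
              (M ⧸ (Θ₀.map (scalarMap E V ϖ)).comap M.subtype),
            ∀ (g : G) (x : Θ₀) (y : M),
              e (Submodule.Quotient.mk x) = Submodule.Quotient.mk y →
              e (Submodule.Quotient.mk (⟨ρ g (x : V), hst₀ g x x.2⟩ : Θ₀))
                = Submodule.Quotient.mk (⟨ρ g (y : V), hstM g y y.2⟩ : M)

end Banach

section IntervalLength

variable {R M : Type*} [Ring R] [AddCommGroup M] [Module R M]

/-- The length of the subquotient `B / A` of a module, for `A ≤ B`. -/
noncomputable def intervalLength (A B : Submodule R M) : ℕ∞ :=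
  Module.length R (B ⧸ A.comap B.subtype)

lemma intervalLength_add {A B C : Submodule R M} (hAB : A ≤ B) (hBC : B ≤ C) :
    intervalLength A C = intervalLength A B + intervalLength B C := by
  have hf : A.comap B.subtype ≤ (A.comap C.subtype).comap (Submodule.inclusion hBC) :=
    fun _ hx => hx
  have hg : A.comap C.subtype ≤ B.comap C.subtype := fun _ hx => hAB hx
  refine Module.length_eq_add_of_exact
    (Submodule.mapQ _ _ (Submodule.inclusion hBC) hf) (Submodule.factor hg) ?_ ?_ ?_
  · rw [injective_iff_map_eq_zero]
    intro x
    induction x using Submodule.Quotient.induction_on with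
    | _ x =>
      rw [Submodule.mapQ_apply, Submodule.Quotient.mk_eq_zero, Submodule.Quotient.mk_eq_zero]
      exact id
  · exact Submodule.factor_surjective hg
  · intro x
    induction x using Submodule.Quotient.induction_on with
    | _ x =>
      constructor
      · intro h
        have hx : (x : M) ∈ B := (Submodule.Quotient.mk_eq_zero (B.comap C.subtype)).1 h
        exact ⟨Submodule.Quotient.mk ⟨x, hx⟩, rfl⟩
      · rintro ⟨y, hy⟩
        induction y using Submodule.Quotient.induction_on with
        | _ y =>
          rw [← hy]
          exact (Submodule.Quotient.mk_eq_zero _).2 y.2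

lemma intervalLength_map (e : M ≃ₗ[R] M) (A B : Submodule R M) :
    intervalLength (A.map (e : M →ₗ[R] M)) (B.map (e : M →ₗ[R] M)) = intervalLength A B := by
  refine (LinearEquiv.length_eq (Submodule.Quotient.equiv _ _ (e.submoduleMap B) ?_)).symm
  ext ⟨x, hx⟩
  constructor
  · rintro ⟨y, hy, h⟩
    exact ⟨y, hy, congrArg Subtype.val h⟩
  · rintro ⟨y, hy, h⟩
    obtain ⟨z, hz, h'⟩ := hx
    have hyz : y = z := e.injective (h.trans h'.symm)
    exact ⟨⟨y, hyz ▸ hz⟩, hy, Subtype.ext h⟩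

lemma intervalLength_eq_one {A B : Submodule R M} (h : A ⋖ B) : intervalLength A B = 1 :=
  Module.length_eq_one_iff.2 ((covBy_iff_quot_is_simple h.le).1 h)

lemma one_le_intervalLength {A B : Submodule R M} (h : A < B) : 1 ≤ intervalLength A B := by
  rw [Order.one_le_iff_ne_zero]
  intro h0
  have hs := Module.length_eq_zero_iff.1 h0
  rw [Submodule.Quotient.subsingleton_iff, Submodule.comap_subtype_eq_top] at hs
  exact h.not_ge hs

lemma eq_of_intervalLength_eq_two {A N P B : Submodule R M} (h2 : intervalLength A B = 2)
    (hAN : A < N) (hNP : N ≤ P) (hPB : P < B) : N = P := by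
  by_contra hne
  have hlt : N < P := lt_of_le_of_ne hNP hne
  rw [intervalLength_add hAN.le (hNP.trans hPB.le), intervalLength_add hNP hPB.le] at h2
  have h3 : (1 : ℕ∞) + (1 + 1) ≤ 2 := h2 ▸ add_le_add (one_le_intervalLength hAN)
    (add_le_add (one_le_intervalLength hlt) (one_le_intervalLength hPB))
  exact absurd h3 (by decide)

end IntervalLength

section Commensurable

variable {R M : Type*} [Ring R] [AddCommGroup M] [Module R M] (e : M ≃ₗ[R] M)

local notation "φ[" f "]" => Submodule.map (LinearEquiv.toLinearMap f)

lemma monotone_iterate_map (k : ℕ) : Monotone (φ[e])^[k] :=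
  Monotone.iterate (fun _ _ h => Submodule.map_mono h) k

lemma iterate_map_sup (k : ℕ) (A B : Submodule R M) :
    (φ[e])^[k] (A ⊔ B) = (φ[e])^[k] A ⊔ (φ[e])^[k] B := by
  induction k with
  | zero => rfl
  | succ k ih => simp only [Function.iterate_succ_apply', ih, Submodule.map_sup]

lemma intervalLength_iterate_map (k : ℕ) (A B : Submodule R M) :
    intervalLength ((φ[e])^[k] A) ((φ[e])^[k] B) = intervalLength A B := by
  induction k with
  | zero => rfl
  | succ k ih => rw [Function.iterate_succ_apply', Function.iterate_succ_apply',
      intervalLength_map, ih]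

variable (he : ∀ N : Submodule R M, φ[e] N ≤ N)
include he

lemma iterate_map_le (k : ℕ) (N : Submodule R M) : (φ[e])^[k] N ≤ N := by
  induction k with
  | zero => exact le_rfl
  | succ k ih => rw [Function.iterate_succ_apply']; exact (he _).trans ih

lemma intervalLength_iterate_map_self_ne_top {L : Submodule R M}
    (hL : intervalLength (φ[e] L) L ≠ ⊤) (k : ℕ) : intervalLength ((φ[e])^[k + 1] L) L ≠ ⊤ := by
  induction k with
  | zero => exact hL
  | succ k ih =>
    rw [Function.iterate_succ_apply', intervalLength_add (Submodule.map_mono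
      (iterate_map_le e he (k + 1) L)) (he L), intervalLength_map]
    exact WithTop.add_ne_top.2 ⟨ih, hL⟩

/-- The length of `L / e L` is the same for commensurable submodules. -/
lemma intervalLength_map_self_eq {L₀ L : Submodule R M}
    (hfin : intervalLength (φ[e] L₀) L₀ ≠ ⊤) {a b : ℕ}
    (ha : (φ[e])^[a] L ≤ L₀) (hb : (φ[e])^[b] L₀ ≤ L) :
    intervalLength (φ[e] L) L = intervalLength (φ[e] L₀) L₀ := by
  rw [← intervalLength_iterate_map e a, ← Function.iterate_succ_apply,
    Function.iterate_succ_apply']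
  have hb' : (φ[e])^[a + b + 1] L₀ ≤ (φ[e])^[a] L := by
    rw [add_assoc, Function.iterate_add_apply]
    refine monotone_iterate_map e a (le_trans ?_ hb)
    rw [Function.iterate_succ_apply']
    exact he _
  generalize (φ[e])^[a] L = N at ha hb'
  have hne : intervalLength N L₀ ≠ ⊤ := by
    have h := intervalLength_iterate_map_self_ne_top e he hfin (a + b)
    rw [intervalLength_add hb' ha] at h
    exact (WithTop.add_ne_top.1 h).2
  have h1 := intervalLength_add (he N) ha
  rw [intervalLength_add (Submodule.map_mono ha) (he L₀), intervalLength_map, add_comm] at h1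
  exact (WithTop.add_right_cancel hne h1).symm

/-- If `A` is maximal in `L` and contains the image of `L` under a power of `e`, then it contains
the image of `L` under `e`. -/
lemma map_le_of_covBy {A L : Submodule R M} (h : A ⋖ L) {k : ℕ} (hk : (φ[e])^[k] L ≤ A) :
    φ[e] L ≤ A := by
  rcases h.eq_or_eq le_sup_left (sup_le h.le (he L)) with hA | hL
  · exact sup_eq_left.1 hA
  · exfalso
    have key : ∀ j, L ≤ A ⊔ (φ[e])^[j] L := by
      intro j
      induction j with
      | zero => exact le_sup_right
      | succ j ih =>
        have hj : (φ[e])^[j] L = (φ[e])^[j] A ⊔ (φ[e])^[j + 1] L := by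
          conv_lhs => rw [← hL]
          rw [iterate_map_sup, Function.iterate_succ_apply]
        rw [hj] at ih
        exact ih.trans (sup_le le_sup_left
          (sup_le ((iterate_map_le e he j A).trans le_sup_left) le_sup_right))
    exact h.lt.not_ge ((key k).trans (sup_le le_rfl hk))

/-- Let `L' ≤ L` be joined by a maximal chain of length `n` and let `L' ≰ e L`. If `N / e N` has
length two for `N` commensurable to `L`, then `e ^ m` maps `L` into `L'` exactly for `n ≤ m`. -/
lemma iterate_map_le_iff {L₀ L' L : Submodule R M} (h2 : intervalLength (φ[e] L₀) L₀ = 2)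
    {a b : ℕ} (ha : (φ[e])^[a] L ≤ L₀) (hb : (φ[e])^[b] L₀ ≤ L') (hsat : ¬ L' ≤ φ[e] L)
    {n : ℕ} {d : ℕ → Submodule R M} (hd0 : d 0 = L') (hdn : d n = L)
    (hcov : ∀ i < n, d i ⋖ d (i + 1)) (m : ℕ) : (φ[e])^[m] L ≤ L' ↔ n ≤ m := by
  have hup : ∀ i, i ≤ n → L' ≤ d i := by
    intro i
    induction i with
    | zero => intro _; exact hd0.ge
    | succ i ih => intro hi; exact (ih (by omega)).trans (hcov i (by omega)).le
  have hdown : ∀ j, j ≤ n → d (n - j) ≤ L := by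
    intro j
    induction j with
    | zero => intro _; exact hdn.le
    | succ j ih =>
      intro hj
      have h := (hcov (n - (j + 1)) (by omega)).le
      rw [show n - (j + 1) + 1 = n - j by omega] at h
      exact h.trans (ih (by omega))
  have hle : ∀ i, i ≤ n → d i ≤ L := fun i hi => by
    have h := hdown (n - i) (by omega)
    rwa [Nat.sub_sub_self hi] at h
  have hk : (φ[e])^[b + a] L ≤ L' := by
    rw [Function.iterate_add_apply]
    exact (monotone_iterate_map e b ha).trans hb
  have hmap : ∀ i < n, φ[e] (d (i + 1)) ≤ d i := fun i hi =>
    map_le_of_covBy e he (hcov i hi) (k := b + a)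
      ((monotone_iterate_map e _ (hle (i + 1) hi)).trans (hk.trans (hup i hi.le)))
  have hstep : ∀ i < n, d i = φ[e] (d (i + 1)) ⊔ L' := by
    intro i hi
    have hlen : intervalLength (φ[e] (d (i + 1))) (d (i + 1)) = 2 := by
      rw [← h2]
      refine intervalLength_map_self_eq e he (by rw [h2]; exact ENat.natCast_ne_top 2)
        ((monotone_iterate_map e a (hle (i + 1) hi)).trans ha) (hb.trans (hup (i + 1) hi))
    refine (eq_of_intervalLength_eq_two hlen ?_ (sup_le (hmap i hi) (hup i hi.le))
      (hcov i hi).lt).symm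
    rw [left_lt_sup]
    exact fun h => hsat (h.trans (Submodule.map_mono (hle (i + 1) hi)))
  have hchain : ∀ j, j ≤ n → d (n - j) = (φ[e])^[j] L ⊔ L' := by
    intro j
    induction j with
    | zero =>
      intro _
      exact hdn.trans (sup_eq_left.2 (hdn ▸ hup n le_rfl)).symm
    | succ j ih =>
      intro hj
      rw [hstep _ (by omega), show n - (j + 1) + 1 = n - j by omega, ih (by omega),
        Submodule.map_sup, Function.iterate_succ_apply', sup_assoc, sup_eq_right.2 (he L')]
  constructor
  · intro hm
    by_contra! hlt
    have h1 := hchain m hlt.le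
    rw [sup_eq_right.2 hm] at h1
    have h2 := hchain (m + 1) hlt
    have h3 : (φ[e])^[m + 1] L ≤ L' := by
      rw [Function.iterate_succ_apply']
      exact (he _).trans hm
    rw [sup_eq_right.2 h3] at h2
    have h4 := (hcov (n - (m + 1)) (by omega)).lt
    rw [show n - (m + 1) + 1 = n - m by omega, h1, h2] at h4
    exact lt_irrefl _ h4
  · intro hnm
    have h := hchain n le_rfl
    rw [Nat.sub_self, hd0] at h
    obtain ⟨r, rfl⟩ := Nat.exists_eq_add_of_le' hnm
    rw [Function.iterate_add_apply]
    exact (iterate_map_le e he r _).trans (le_sup_left.trans h.ge)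

end Commensurable

section StableSubmodules

variable {E : Type*} [NormedField E] [IsUltrametricDist E]
  {V : Type*} [NormedAddCommGroup V] [NormedSpace E V] {G : Type*} [Group G]

/-- The ring of `E`-linear endomorphisms preserving every `G`-stable `O`-submodule. -/
def stableEnd (ρ : G →* (V ≃L[E] V)) : Subring (Module.End E V) where
  carrier := {f | ∀ N : Submodule (intRing E) V, GStable E V G ρ N → ∀ x ∈ N, f x ∈ N}
  one_mem' := fun _ _ _ hx => hx
  mul_mem' := fun ha hb N hN x hx => ha N hN _ (hb N hN x hx)
  add_mem' := fun ha hb N hN x hx => N.add_mem (ha N hN x hx) (hb N hN x hx)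
  zero_mem' := fun N _ _ _ => N.zero_mem
  neg_mem' := fun ha N hN x hx => N.neg_mem (ha N hN x hx)

variable {ρ : G →* (V ≃L[E] V)}

lemma smul_mem_of_norm_le_one (N : Submodule (intRing E) V) {o : E} (ho : ‖o‖ ≤ 1) {x : V}
    (hx : x ∈ N) : o • x ∈ N :=
  N.smul_mem (⟨o, ho⟩ : intRing E) hx

/-- A `G`-stable `O`-submodule as a module over `stableEnd ρ`. -/
def GStable.toStableEnd {N : Submodule (intRing E) V} (hN : GStable E V G ρ N) :
    Submodule (stableEnd ρ) V where
  carrier := N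
  add_mem' := N.add_mem
  zero_mem' := N.zero_mem
  smul_mem' f x hx := f.2 N hN x hx

lemma smul_mem_of_stableEnd (D : Submodule (stableEnd ρ) V) {o : E} (ho : ‖o‖ ≤ 1) {x : V}
    (hx : x ∈ D) : o • x ∈ D :=
  D.smul_mem (⟨o • (1 : Module.End E V), fun N _ _ hy => smul_mem_of_norm_le_one N ho hy⟩ :
    stableEnd ρ) hx

/-- The `O`-submodule underlying a module over `stableEnd ρ`. -/
def toIntRing (D : Submodule (stableEnd ρ) V) : Submodule (intRing E) V where
  carrier := D
  add_mem' := D.add_mem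
  zero_mem' := D.zero_mem
  smul_mem' o _ hx := smul_mem_of_stableEnd D o.2 hx

lemma gStable_toIntRing (D : Submodule (stableEnd ρ) V) : GStable E V G ρ (toIntRing D) :=
  fun g _ hx => D.smul_mem (⟨((ρ g : V →L[E] V) : V →ₗ[E] V), fun _ hN y hy => hN g y hy⟩ :
    stableEnd ρ) hx

lemma GStable.map_scalarMap {N : Submodule (intRing E) V} (hN : GStable E V G ρ N) (c : E) :
    GStable E V G ρ (N.map (scalarMap E V c)) := by
  rintro g _ ⟨y, hy, rfl⟩
  exact ⟨ρ g y, hN g y hy, ((ρ g).map_smul c y).symm⟩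

lemma GStable.covBy {A B : Submodule (intRing E) V} (hA : GStable E V G ρ A)
    (hB : GStable E V G ρ B) (hlt : A < B)
    (hmax : ∀ N : Submodule (intRing E) V, GStable E V G ρ N → A ≤ N → N ≤ B → N = A ∨ N = B) :
    hA.toStableEnd ⋖ hB.toStableEnd := by
  refine ⟨⟨hlt.le, hlt.not_ge⟩, fun D hAD hDB => ?_⟩
  rcases hmax (toIntRing D) (gStable_toIntRing D) hAD.le hDB.le with h | h
  · exact hAD.not_ge h.le
  · exact hDB.not_ge h.ge

variable (ρ) in
/-- Multiplication by a nonzero scalar as an automorphism over `stableEnd ρ`. -/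
def smulStableEquiv {c : E} (hc : c ≠ 0) : V ≃ₗ[stableEnd ρ] V where
  toFun v := c • v
  map_add' := smul_add c
  map_smul' f v := ((f : Module.End E V).map_smul c v).symm
  invFun v := c⁻¹ • v
  left_inv v := inv_smul_smul₀ hc v
  right_inv v := smul_inv_smul₀ hc v

lemma mem_iterate_map_smulStableEquiv {c : E} (hc : c ≠ 0) (k : ℕ)
    (D : Submodule (stableEnd ρ) V) {x : V} :
    x ∈ (Submodule.map (smulStableEquiv ρ hc).toLinearMap)^[k] D ↔ ∃ y ∈ D, c ^ k • y = x := by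
  induction k generalizing x with
  | zero => simp
  | succ k ih =>
    rw [Function.iterate_succ_apply', Submodule.mem_map]
    constructor
    · rintro ⟨z, hz, rfl⟩
      obtain ⟨y, hy, rfl⟩ := ih.1 hz
      exact ⟨y, hy, by rw [pow_succ', mul_smul]; rfl⟩
    · rintro ⟨y, hy, rfl⟩
      exact ⟨c ^ k • y, ih.2 ⟨y, hy, rfl⟩, by rw [pow_succ', mul_smul]; rfl⟩

lemma iterate_map_smulStableEquiv_le_iff {c : E} (hc : c ≠ 0) (k : ℕ)
    {A B : Submodule (stableEnd ρ) V} :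
    (Submodule.map (smulStableEquiv ρ hc).toLinearMap)^[k] A ≤ B ↔ ∀ x ∈ A, c ^ k • x ∈ B := by
  constructor
  · exact fun h x hx => h ((mem_iterate_map_smulStableEquiv hc k A).2 ⟨x, hx, rfl⟩)
  · intro h x hx
    obtain ⟨y, hy, rfl⟩ := (mem_iterate_map_smulStableEquiv hc k A).1 hx
    exact h y hy

/-- Lattices are commensurable. -/
lemma IsLat.exists_pow_smul_mem {A B : Submodule (intRing E) V} (hA : IsLat E V A)
    (hB : IsLat E V B) {ϖ : E} (hϖ1 : ‖ϖ‖ < 1) : ∃ k : ℕ, ∀ x ∈ A, ϖ ^ k • x ∈ B := by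
  obtain ⟨C, hC0, hC⟩ := hA.2.exists_pos_norm_le
  obtain ⟨ε, hε, hball⟩ := Metric.isOpen_iff.1 hB.1 0 B.zero_mem
  obtain ⟨k, hk⟩ := exists_pow_lt_of_lt_one (div_pos hε hC0) hϖ1
  refine ⟨k, fun x hx => hball ?_⟩
  rw [mem_ball_zero_iff, norm_smul, norm_pow]
  calc ‖ϖ‖ ^ k * ‖x‖ ≤ ‖ϖ‖ ^ k * C := by gcongr; exact hC x hx
    _ < ε := (lt_div_iff₀ hC0).1 hk

lemma ResidualLengthTwo.exists_intervalLength {ϖ : E} (hϖ0 : ϖ ≠ 0)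
    (hres : ResidualLengthTwo E V G ϖ ρ) :
    ∃ (Θ₀ : Submodule (intRing E) V) (hst₀ : GStable E V G ρ Θ₀), IsLat E V Θ₀ ∧
      intervalLength (hst₀.toStableEnd.map (smulStableEquiv ρ hϖ0).toLinearMap)
        hst₀.toStableEnd = 2 := by
  obtain ⟨Θ₀, hlat₀, hst₀, M, hstM, hlt, hlt', hmax, hmax', -⟩ := hres
  refine ⟨Θ₀, hst₀, hlat₀, ?_⟩
  have h1 := (hst₀.map_scalarMap ϖ).covBy hstM hlt hmax
  have h2 := hstM.covBy hst₀ hlt' hmax'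
  have h := intervalLength_add h1.le h2.le
  rw [intervalLength_eq_one h1, intervalLength_eq_one h2, one_add_one_eq_two] at h
  exact h

/-- In terms of a generator `ϖ` of the value group, the scalars mapping `A` into `B` are
determined by the powers of `ϖ` which do so. -/
lemma smul_mem_iff_of_pow_smul_mem_iff {ϖ : E} (hϖ0 : ϖ ≠ 0) (hϖ1 : ‖ϖ‖ < 1)
    (hdisc : ∀ x : E, x ≠ 0 → ∃ m : ℤ, ‖x‖ = ‖ϖ‖ ^ m) {A B : Submodule (intRing E) V} {n : ℕ}
    (h : ∀ m : ℕ, (∀ x ∈ A, ϖ ^ m • x ∈ B) ↔ n ≤ m) {a : E} (ha : ‖a‖ ≤ 1) :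
    (∀ x ∈ A, a • x ∈ B) ↔ ∃ b : E, ‖b‖ ≤ 1 ∧ a = ϖ ^ n * b := by
  have hϖ : 0 < ‖ϖ‖ := norm_pos_iff.2 hϖ0
  constructor
  · intro hab
    rcases eq_or_ne a 0 with rfl | ha0
    · exact ⟨0, by simp, by simp⟩
    obtain ⟨z, hz⟩ := hdisc a ha0
    have hz0 : 0 ≤ z := by
      by_contra! hneg
      exact (hz ▸ ha).not_gt (one_lt_zpow_of_neg₀ hϖ hϖ1 hneg)
    lift z to ℕ using hz0 with m
    rw [zpow_natCast] at hz
    have hnm : n ≤ m := by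
      refine (h m).1 fun x hx => ?_
      have hu : ‖ϖ ^ m / a‖ ≤ 1 := by
        rw [norm_div, norm_pow, ← hz, div_self (norm_ne_zero_iff.2 ha0)]
      have hmem := smul_mem_of_norm_le_one B hu (hab x hx)
      rwa [smul_smul, div_mul_cancel₀ _ ha0] at hmem
    refine ⟨a / ϖ ^ n, ?_, (mul_div_cancel₀ _ (pow_ne_zero n hϖ0)).symm⟩
    rw [norm_div, norm_pow, hz]
    exact div_le_one_of_le₀ (pow_le_pow_of_le_one hϖ.le hϖ1.le hnm) (by positivity)
  · rintro ⟨b, hb, rfl⟩ x hx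
    rw [mul_comm, mul_smul]
    exact smul_mem_of_norm_le_one B hb ((h n).2 le_rfl x hx)

end StableSubmodules

/-- Let `Θ' ⊆ Θ` be `G`-stable lattices in `Π` with saturated inclusion
(`Θ' ⊄ ϖΘ`) such that the `O[G]`-module `Θ/Θ'` has composition length `n` (witnessed by a
maximal chain of `G`-stable `O`-submodules from `Θ'` to `Θ` of length `n`).  Then the
annihilator of `Θ/Θ'` in `O` is exactly `ϖⁿO`. -/
theorem statement9
    (E : Type*) [NormedField E] [CompleteSpace E] [IsUltrametricDist E]
    -- ϖ is a uniformizer of the discretely valued field E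
    (ϖ : E) (hϖ0 : ϖ ≠ 0) (hϖ1 : ‖ϖ‖ < 1)
    (hdisc : ∀ x : E, x ≠ 0 → ∃ m : ℤ, ‖x‖ = ‖ϖ‖ ^ m)
    -- Π is a nonzero E-Banach space with a topologically irreducible G-action
    (V : Type*) [NormedAddCommGroup V] [NormedSpace E V] [CompleteSpace V] [Nontrivial V]
    (G : Type*) [Group G] (ρ : G →* (V ≃L[E] V))
    (hirr : ∀ Y : Submodule E V, IsClosed (Y : Set V) →
      (∀ g : G, ∀ x ∈ Y, ρ g x ∈ Y) → Y = ⊥ ∨ Y = ⊤)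
    -- standing assumption: residual length two with distinct factors
    (hres : ResidualLengthTwo E V G ϖ ρ)
    -- Θ' ⊆ Θ, G-stable lattices, saturated inclusion
    (Θ' Θ : Submodule (intRing E) V)
    (hlat' : IsLat E V Θ') (hlat : IsLat E V Θ)
    (hst' : GStable E V G ρ Θ') (hst : GStable E V G ρ Θ)
    (hle : Θ' ≤ Θ)
    (hsat : ¬ Θ' ≤ Θ.map (scalarMap E V ϖ))
    -- Θ/Θ' has composition length n, witnessed by a maximal chain of G-stable submodules
    (n : ℕ) (c : ℕ → Submodule (intRing E) V)
    (hc0 : c 0 = Θ') (hcn : c n = Θ)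
    (hcstab : ∀ i ≤ n, GStable E V G ρ (c i))
    (hcstrict : ∀ i < n, c i < c (i + 1))
    (hcmax : ∀ i < n, ∀ N : Submodule (intRing E) V, GStable E V G ρ N →
      c i ≤ N → N ≤ c (i + 1) → N = c i ∨ N = c (i + 1)) :
    ∀ a : E, ‖a‖ ≤ 1 →
      ((∀ x ∈ Θ, a • x ∈ Θ') ↔ ∃ b : E, ‖b‖ ≤ 1 ∧ a = ϖ ^ n * b) := by
  intro a ha
  obtain ⟨Θ₀, hst₀, hlat₀, h2⟩ := hres.exists_intervalLength hϖ0
  obtain ⟨p, hp⟩ := hlat.exists_pow_smul_mem hlat₀ hϖ1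
  obtain ⟨q, hq⟩ := hlat₀.exists_pow_smul_mem hlat' hϖ1
  have he : ∀ N : Submodule (stableEnd ρ) V,
      N.map (smulStableEquiv ρ hϖ0).toLinearMap ≤ N := by
    rintro N _ ⟨x, hx, rfl⟩
    exact smul_mem_of_stableEnd N hϖ1.le hx
  have hex : ∀ i, ∃ D : Submodule (stableEnd ρ) V,
      ∀ hi : i ≤ n, D = (hcstab i hi).toStableEnd := by
    intro i
    by_cases hi : i ≤ n
    · exact ⟨(hcstab i hi).toStableEnd, fun _ => rfl⟩
    · exact ⟨⊥, fun h => absurd h hi⟩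
  choose d hd using hex
  have hcov : ∀ i < n, d i ⋖ d (i + 1) := by
    intro i hi
    rw [hd i hi.le, hd (i + 1) hi]
    exact (hcstab i hi.le).covBy (hcstab (i + 1) hi) (hcstrict i hi) (hcmax i hi)
  have hd0 : d 0 = hst'.toStableEnd := by
    rw [hd 0 n.zero_le]
    congr 1
  have hdn : d n = hst.toStableEnd := by
    rw [hd n le_rfl]
    congr 1
  refine smul_mem_iff_of_pow_smul_mem_iff hϖ0 hϖ1 hdisc (fun m => ?_) ha
  exact (iterate_map_smulStableEquiv_le_iff hϖ0 m).symm.trans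
    (iterate_map_le_iff (L' := hst'.toStableEnd) (L := hst.toStableEnd) _ he h2
      ((iterate_map_smulStableEquiv_le_iff hϖ0 p).2 hp)
      ((iterate_map_smulStableEquiv_le_iff hϖ0 q).2 hq) hsat hd0 hdn hcov m)
end

section
/- For every n ≥ 0, the Iwahori subgroup Iw = K₀(p) of GL₂(ℤ_p) is the union, over i = 1, …, n+1, of the double cosets K₀(p^{n+1}) · u_i · B(ℤ_p), where u_i denotes the matrix (1 0; p^i 1), and these n+1 double cosets are pairwise disjoint. -/
open Matrix

variable (p : ℕ) [Fact p.Prime]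

/-- `GL₂(ℤ_p)`. -/
abbrev GLZ := Matrix.GeneralLinearGroup (Fin 2) ℤ_[p]

/-- The subgroup `K₀(pⁿ)` of `GL₂(ℤ_p)`: matrices whose `(2,1)` entry lies in `pⁿℤ_p`. -/
def K0 (n : ℕ) : Subgroup (GLZ p) where
  carrier := {g | (p : ℤ_[p]) ^ n ∣ (g : Matrix (Fin 2) (Fin 2) ℤ_[p]) 1 0}
  one_mem' := by
    simp only [Set.mem_setOf_eq, Units.val_one, Matrix.one_apply_ne (by decide : (1 : Fin 2) ≠ 0)]
    exact dvd_zero _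
  mul_mem' := by
    intro a b ha hb
    simp only [Set.mem_setOf_eq, Units.val_mul, Matrix.mul_apply, Fin.sum_univ_two] at *
    exact dvd_add (ha.mul_right _) (hb.mul_left _)
  inv_mem' := by
    intro a ha
    simp only [Set.mem_setOf_eq] at *
    have h1 : ((a⁻¹ : GLZ p) : Matrix (Fin 2) (Fin 2) ℤ_[p])
        = ((a : Matrix (Fin 2) (Fin 2) ℤ_[p]))⁻¹ := Matrix.coe_units_inv a
    rw [h1, Matrix.inv_def, Matrix.smul_apply, Matrix.adjugate_fin_two]
    simp only [Matrix.cons_val', Matrix.cons_val_zero, Matrix.cons_val_one, Matrix.head_cons,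
      Matrix.empty_val', Matrix.cons_val_fin_one, Matrix.head_fin_const, smul_eq_mul]
    exact (ha.neg_right).mul_left _

/-- The subgroup of upper-triangular matrices in `GL₂(R)`. -/
def Bsub (R : Type*) [CommRing R] : Subgroup (Matrix.GeneralLinearGroup (Fin 2) R) where
  carrier := {g | (g : Matrix (Fin 2) (Fin 2) R) 1 0 = 0}
  one_mem' := by
    simp only [Set.mem_setOf_eq, Units.val_one, Matrix.one_apply_ne (by decide : (1 : Fin 2) ≠ 0)]
  mul_mem' := by
    intro a b ha hb
    simp only [Set.mem_setOf_eq, Units.val_mul, Matrix.mul_apply, Fin.sum_univ_two] at *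
    rw [ha, hb]; ring
  inv_mem' := by
    intro a ha
    simp only [Set.mem_setOf_eq] at *
    have h1 : ((a⁻¹ : Matrix.GeneralLinearGroup (Fin 2) R) : Matrix (Fin 2) (Fin 2) R)
        = ((a : Matrix (Fin 2) (Fin 2) R))⁻¹ := Matrix.coe_units_inv a
    simp [h1, Matrix.inv_def, Matrix.adjugate_fin_two, ha]

/-- The unipotent matrix `u_i = (1 0; p^i 1)` as an element of `GL₂(ℤ_p)`. -/
noncomputable def uMat (i : ℕ) : GLZ p where
  val := !![1, 0; (p : ℤ_[p]) ^ i, 1]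
  inv := !![1, 0; -(p : ℤ_[p]) ^ i, 1]
  val_inv := by
    ext a b
    fin_cases a <;> fin_cases b <;>
      simp [Matrix.mul_apply, Fin.sum_univ_two, Matrix.one_apply]
  inv_val := by
    ext a b
    fin_cases a <;> fin_cases b <;>
      simp [Matrix.mul_apply, Fin.sum_univ_two, Matrix.one_apply]

/-- The double coset `K₀(p^{n+1}) · u_i · B(ℤ_p)` inside `GL₂(ℤ_p)`. -/
def dcoset (n i : ℕ) : Set (GLZ p) :=
  {g | ∃ h ∈ K0 p (n+1), ∃ b ∈ Bsub ℤ_[p], g = h * uMat p i * b}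

theorem PadicInt.isUnit_iff_not_dvd (x : ℤ_[p]) : IsUnit x ↔ ¬ (p : ℤ_[p]) ∣ x := by
  rw [PadicInt.isUnit_iff, ← PadicInt.norm_lt_one_iff_dvd, not_lt]
  exact ⟨fun h => h.ge, fun h => (PadicInt.norm_le_one x).antisymm h⟩

theorem isUnit_apply_one_one_of_dvd {g : GLZ p} (hg : (p : ℤ_[p]) ∣ g.1 1 0) :
    IsUnit (g.1 1 1) := by
  rw [PadicInt.isUnit_iff_not_dvd]
  intro hd
  have hdet : IsUnit g.1.det := (Matrix.isUnit_iff_isUnit_det _).1 g.isUnit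
  rw [PadicInt.isUnit_iff_not_dvd, Matrix.det_fin_two] at hdet
  exact hdet (dvd_sub (hd.mul_left _) (hg.mul_left _))

/-- The powers of `p` up to `p ^ (n + 1)` dividing the lower left entry determine the
double coset. -/
theorem pow_dvd_iff_of_mem_dcoset {n i k : ℕ} (hk : k ≤ n + 1) {g : GLZ p}
    (hg : g ∈ dcoset p n i) : (p : ℤ_[p]) ^ k ∣ g.1 1 0 ↔ k ≤ i := by
  obtain ⟨h, hh, b, hb, rfl⟩ := hg
  replace hh : (p : ℤ_[p]) ^ (n + 1) ∣ h.1 1 0 := hh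
  replace hb : b.1 1 0 = 0 := hb
  have hd := isUnit_apply_one_one_of_dvd p ((dvd_pow_self _ n.succ_ne_zero).trans hh)
  have hx : IsUnit (b.1 0 0) := by
    have hdet : IsUnit b.1.det := (Matrix.isUnit_iff_isUnit_det _).1 b.isUnit
    rw [Matrix.det_fin_two, hb, mul_zero, sub_zero] at hdet
    exact isUnit_of_mul_isUnit_left hdet
  have key : (h * uMat p i * b).1 1 0
      = (h.1 1 0 + h.1 1 1 * (p : ℤ_[p]) ^ i) * b.1 0 0 := by
    simp [uMat, Matrix.mul_apply, Fin.sum_univ_two, hb]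
  rw [key, hx.dvd_mul_right, dvd_add_right ((pow_dvd_pow _ hk).trans hh), hd.dvd_mul_left]
  exact pow_dvd_pow_iff PadicInt.prime_p.ne_zero PadicInt.prime_p.not_isUnit

theorem mem_dcoset_of_unit {n i : ℕ} {g : GLZ p} (x : ℤ_[p]ˣ)
    (h : (p : ℤ_[p]) ^ (n + 1) ∣ g.1 1 0 * ↑x⁻¹ - g.1 1 1 * (p : ℤ_[p]) ^ i) :
    g ∈ dcoset p n i := by
  let b : GLZ p :=
    { val := !![(x : ℤ_[p]), 0; 0, 1]
      inv := !![(↑x⁻¹ : ℤ_[p]), 0; 0, 1]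
      val_inv := by simp [Matrix.one_fin_two]
      inv_val := by simp [Matrix.one_fin_two] }
  refine ⟨g * b⁻¹ * (uMat p i)⁻¹, ?_, b, rfl, by group⟩
  have key : (g * b⁻¹ * (uMat p i)⁻¹).1 1 0
      = g.1 1 0 * ↑x⁻¹ - g.1 1 1 * (p : ℤ_[p]) ^ i := by
    change (g.1 * !![(↑x⁻¹ : ℤ_[p]), 0; 0, 1] * !![1, 0; -(p : ℤ_[p]) ^ i, 1]) 1 0 = _
    simp [Matrix.mul_apply, Fin.sum_univ_two, sub_eq_add_neg]
  change (p : ℤ_[p]) ^ (n + 1) ∣ (g * b⁻¹ * (uMat p i)⁻¹).1 1 0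
  rwa [key]

theorem exists_mem_dcoset_of_mem_K0_one {n : ℕ} {g : GLZ p} (hg : g ∈ K0 p 1) :
    ∃ i ∈ Finset.Icc 1 (n + 1), g ∈ dcoset p n i := by
  replace hg : (p : ℤ_[p]) ^ 1 ∣ g.1 1 0 := hg
  rw [pow_one] at hg
  by_cases hn : (p : ℤ_[p]) ^ (n + 1) ∣ g.1 1 0
  · exact ⟨n + 1, by simp, mem_dcoset_of_unit p 1
      (dvd_sub (hn.mul_right _) (dvd_mul_left _ _))⟩
  have h0 : g.1 1 0 ≠ 0 := fun h => hn (h ▸ dvd_zero _)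
  obtain ⟨d, hd⟩ := isUnit_apply_one_one_of_dvd p hg
  have hv := PadicInt.unitCoeff_spec h0
  set v := PadicInt.unitCoeff h0
  set i := (g.1 1 0).valuation
  have hi : 1 ≤ i := by
    by_contra! hlt
    rw [Nat.lt_one_iff.1 hlt, pow_zero, mul_one] at hv
    exact (PadicInt.isUnit_iff_not_dvd p _).1 v.isUnit (hv ▸ hg)
  have hin : i ≤ n + 1 := by
    by_contra! hlt
    exact hn (hv ▸ (pow_dvd_pow _ hlt.le).mul_left _)
  refine ⟨i, Finset.mem_Icc.2 ⟨hi, hin⟩, mem_dcoset_of_unit p (v * d⁻¹) ?_⟩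
  convert dvd_zero _
  rw [hv, ← hd, mul_inv, inv_inv, Units.val_mul]
  linear_combination (d : ℤ_[p]) * (p : ℤ_[p]) ^ i * v.mul_inv

/-- For every `n ≥ 0`, the Iwahori subgroup `Iw = K₀(p)` is the disjoint
union of the double cosets `K₀(p^{n+1}) u_i B(ℤ_p)` for `i = 1, …, n+1`, where
`u_i = (1 0; p^i 1)`. -/
theorem statement13 (p : ℕ) [Fact p.Prime] (n : ℕ) :
    (((K0 p 1 : Subgroup (GLZ p)) : Set (GLZ p)) = ⋃ i ∈ Finset.Icc 1 (n+1), dcoset p n i) ∧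
    ∀ i ∈ Finset.Icc 1 (n+1), ∀ j ∈ Finset.Icc 1 (n+1), i ≠ j →
      Disjoint (dcoset p n i) (dcoset p n j) := by
  refine ⟨Set.ext fun g => ?_, fun i hi j hj hij => Set.disjoint_left.2 fun g hgi hgj => hij ?_⟩
  · simp only [Set.mem_iUnion, exists_prop, SetLike.mem_coe]
    refine ⟨exists_mem_dcoset_of_mem_K0_one p, fun ⟨i, hi, hg⟩ => ?_⟩
    exact (pow_dvd_iff_of_mem_dcoset p (by lia) hg).2 (Finset.mem_Icc.1 hi).1
  · rw [Finset.mem_Icc] at hi hj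
    exact ((pow_dvd_iff_of_mem_dcoset p hi.2 hgj).1
      ((pow_dvd_iff_of_mem_dcoset p hi.2 hgi).2 le_rfl)).antisymm
      ((pow_dvd_iff_of_mem_dcoset p hj.2 hgi).1
      ((pow_dvd_iff_of_mem_dcoset p hj.2 hgj).2 le_rfl))
end

section
/- Let R be a ring and M an R-module such that every nonzero R-submodule of M contains a simple submodule, and such that M = ⋃_{i≥0} soc^i(M). Then the R-submodules of M are totally ordered by inclusion (M is uniserial) if and only if for every i ≥ 0 the layer soc^{i+1}(M)/soc^i(M) is either a simple R-module or zero. -/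
/-- The socle of a module: the sum of all simple submodules. -/
def socle (R M : Type*) [Ring R] [AddCommGroup M] [Module R M] : Submodule R M :=
  sSup {S : Submodule R M | IsSimpleModule R S}

/-- The socle filtration of a module: `soc⁰ M = ⊥` and `soc^{i+1} M` is the preimage in `M`
of the socle of `M / socⁱ M`. -/
def socSeries (R M : Type*) [Ring R] [AddCommGroup M] [Module R M] : ℕ → Submodule R M
  | 0 => ⊥
  | (i + 1) => (socle R (M ⧸ socSeries R M i)).comap (socSeries R M i).mkQ

theorem le_socle {R M : Type*} [Ring R] [AddCommGroup M] [Module R M] {P : Submodule R M}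
    (h : IsAtom P) : P ≤ socle R M :=
  le_sSup (isSimpleModule_iff_isAtom.2 h)

theorem isAtom_map_mkQ_iff {R M : Type*} [Ring R] [AddCommGroup M] [Module R M]
    {A P : Submodule R M} (hAP : A ≤ P) : IsAtom (P.map A.mkQ) ↔ A ⋖ P := by
  rw [← Set.Ici.isAtom_iff (a := A) (b := ⟨P, hAP⟩),
    ← (Submodule.comapMkQRelIso A).isAtom_iff]
  have h : Submodule.comapMkQRelIso A (P.map A.mkQ) = ⟨P, hAP⟩ :=
    Subtype.ext (by simp [Submodule.comapMkQRelIso, hAP])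
  rw [h]

theorem socSeries_le_succ (R M : Type*) [Ring R] [AddCommGroup M] [Module R M] (i : ℕ) :
    socSeries R M i ≤ socSeries R M (i + 1) :=
  Submodule.le_comap_mkQ _ _

theorem le_socSeries_succ_of_covBy {R M : Type*} [Ring R] [AddCommGroup M] [Module R M] {i : ℕ}
    {P : Submodule R M} (h : socSeries R M i ⋖ P) : P ≤ socSeries R M (i + 1) :=
  Submodule.map_le_iff_le_comap.1 (le_socle ((isAtom_map_mkQ_iff h.le).2 h))

theorem socSeries_succ_le {R M : Type*} [Ring R] [AddCommGroup M] [Module R M] {i : ℕ}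
    {Q : Submodule R M} (hQ : socSeries R M i ≤ Q)
    (h : ∀ P, socSeries R M i ⋖ P → P ≤ Q) : socSeries R M (i + 1) ≤ Q := by
  have key : socle R (M ⧸ socSeries R M i) ≤ Q.map (socSeries R M i).mkQ := by
    refine sSup_le fun T hT => ?_
    have hmap : (T.comap (socSeries R M i).mkQ).map (socSeries R M i).mkQ = T :=
      Submodule.map_comap_eq_of_surjective (Submodule.mkQ_surjective _) T
    rw [← hmap]
    refine Submodule.map_mono (h _ ?_)
    rw [← isAtom_map_mkQ_iff (Submodule.le_comap_mkQ _ _), hmap]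
    exact isSimpleModule_iff_isAtom.1 hT
  refine (Submodule.comap_mono key).trans ?_
  rw [Submodule.comap_map_mkQ, sup_eq_right.2 hQ]

/-- If every layer of the socle filtration is simple or zero, a submodule containing `socⁱ M`
is equal to it or contains `soc^{i+1} M`. -/
theorem le_socSeries_or_socSeries_succ_le {R M : Type*} [Ring R] [AddCommGroup M] [Module R M]
    (hexh : ⨆ i, socSeries R M i = ⊤)
    (hlayer : ∀ i, socSeries R M i ⩿ socSeries R M (i + 1))
    {i : ℕ} {N : Submodule R M} (hi : socSeries R M i ≤ N) :
    N ≤ socSeries R M i ∨ socSeries R M (i + 1) ≤ N := by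
  classical
  have hmono : Monotone (socSeries R M) := monotone_nat_of_le_succ (socSeries_le_succ R M)
  refine or_iff_not_imp_left.2 fun hN => ?_
  have hex : ∃ k, ¬ N ⊓ socSeries R M k ≤ socSeries R M i := by
    obtain ⟨x, hxN, hx⟩ := SetLike.not_le_iff_exists.1 hN
    obtain ⟨k, hk⟩ := (Submodule.mem_iSup_of_directed _ hmono.directed_le).1
      (hexh ▸ Submodule.mem_top : x ∈ ⨆ i, socSeries R M i)
    exact ⟨k, fun h => hx (h ⟨hxN, hk⟩)⟩
  obtain ⟨j, hj, hmin⟩ : ∃ j, ¬ N ⊓ socSeries R M (j + 1) ≤ socSeries R M i ∧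
      N ⊓ socSeries R M j ≤ socSeries R M i := by
    have hspec := Nat.find_spec hex
    cases hk : Nat.find hex with
    | zero => exact absurd (inf_le_right.trans (hmono (Nat.zero_le i))) (hk ▸ hspec)
    | succ j => exact ⟨j, hk ▸ hspec, not_not.1 (Nat.find_min hex (by omega))⟩
  have hij : i ≤ j := by
    by_contra hlt
    exact hj (inf_le_right.trans (hmono (by omega)))
  set P := N ⊓ socSeries R M (j + 1) with hP
  have hinf : P ⊓ socSeries R M j = socSeries R M i := by
    refine le_antisymm ((inf_le_inf_right _ inf_le_left).trans hmin) ?_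
    exact le_inf (le_inf hi (hmono (by omega))) (hmono hij)
  have hPj : ¬ P ≤ socSeries R M j := fun h => hj (hinf ▸ le_inf le_rfl h)
  have hsup : P ⊔ socSeries R M j = socSeries R M (j + 1) :=
    ((hlayer j).eq_or_eq le_sup_right (sup_le inf_le_right (socSeries_le_succ R M j))).resolve_left
      fun h => hPj (h ▸ le_sup_left)
  have hcov : socSeries R M j ⋖ P ⊔ socSeries R M j :=
    (hsup ▸ hlayer j).covBy_of_lt (lt_of_le_not_ge le_sup_right fun h => hPj (le_sup_left.trans h))
  have hiP : socSeries R M i ⋖ P := hinf ▸ inf_covBy_of_covBy_sup_right hcov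
  have hPeq := ((hlayer i).eq_or_eq hiP.le (le_socSeries_succ_of_covBy hiP)).resolve_left hiP.ne'
  exact hPeq ▸ inf_le_left

/-- Let `M` be an `R`-module in which every nonzero submodule contains a
simple submodule, and which is the union of its socle filtration.  Then `M` is uniserial
(its submodules are totally ordered by inclusion) if and only if each layer
`soc^{i+1}(M)/socⁱ(M)` is simple or zero. -/
theorem statement16 (R M : Type*) [Ring R] [AddCommGroup M] [Module R M]
    (hsoc : ∀ N : Submodule R M, N ≠ ⊥ → ∃ S : Submodule R M, S ≤ N ∧ IsSimpleModule R S)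
    (hexh : ⨆ i, socSeries R M i = ⊤) :
    (∀ N N' : Submodule R M, N ≤ N' ∨ N' ≤ N) ↔
      (∀ i : ℕ,
        IsSimpleModule R
          ((socSeries R M (i+1)) ⧸ (socSeries R M i).comap (socSeries R M (i+1)).subtype) ∨
        Subsingleton
          ((socSeries R M (i+1)) ⧸ (socSeries R M i).comap (socSeries R M (i+1)).subtype)) := by
  have hlayer : ∀ i : ℕ,
      (IsSimpleModule R
          ((socSeries R M (i+1)) ⧸ (socSeries R M i).comap (socSeries R M (i+1)).subtype) ∨
        Subsingleton
          ((socSeries R M (i+1)) ⧸ (socSeries R M i).comap (socSeries R M (i+1)).subtype)) ↔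
      socSeries R M i ⩿ socSeries R M (i + 1) := by
    intro i
    have hle := socSeries_le_succ R M i
    rw [← covBy_iff_quot_is_simple hle, Submodule.Quotient.subsingleton_iff,
      Submodule.comap_subtype_eq_top, wcovBy_iff_covBy_or_eq, hle.ge_iff_eq]
  simp only [hlayer]
  constructor
  · intro huni i
    by_cases hex : ∃ P, socSeries R M i ⋖ P
    · obtain ⟨P, hP⟩ := hex
      have heq : socSeries R M (i + 1) = P := by
        refine le_antisymm (socSeries_succ_le hP.le fun P' hP' => ?_)
          (le_socSeries_succ_of_covBy hP)
        rcases huni P' P with h | h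
        · exact h
        · exact ((hP'.eq_or_eq hP.le h).resolve_left hP.ne').ge
      exact heq ▸ hP.wcovBy
    · have heq : socSeries R M (i + 1) = socSeries R M i :=
        le_antisymm (socSeries_succ_le le_rfl fun P hP => (hex ⟨P, hP⟩).elim)
          (socSeries_le_succ R M i)
      exact heq ▸ WCovBy.refl _
  · intro hl N N'
    by_cases hall : ∀ i, socSeries R M i ≤ N ∧ socSeries R M i ≤ N'
    · exact Or.inl (le_top.trans (hexh ▸ iSup_le fun i => (hall i).2))
    · by_contra hne
      refine hall fun i => ?_
      induction i with
      | zero => exact ⟨bot_le, bot_le⟩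
      | succ i ih =>
        rw [not_or] at hne
        exact ⟨(le_socSeries_or_socSeries_succ_le hexh hl ih.1).resolve_left
            fun h => hne.1 (h.trans ih.2),
          (le_socSeries_or_socSeries_succ_le hexh hl ih.2).resolve_left
            fun h => hne.2 (h.trans ih.1)⟩
end

section
/- Let ρ₁, ρ₂ : Γ → GL₂(E) be absolutely irreducible continuous representations such that det ρ₁ = det ρ₂ and such that the restrictions ρ₁|_I and ρ₂|_I are isomorphic (conjugate by an element of GL₂(E)). Then there exists a continuous character η : Γ → E^× with η trivial on I and η² = 1 such that ρ₁ is isomorphic to ρ₂ ⊗ η, i.e. ρ₁ is conjugate in GL₂(E) to the representation g ↦ η(g)·ρ₂(g). -/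
open Matrix

variable (p : ℕ) [Fact p.Prime]

/-- The algebraic closure `ℚ̄_p` of `ℚ_p`. -/
abbrev QpBar (p : ℕ) [Fact p.Prime] := AlgebraicClosure ℚ_[p]

/-- The absolute Galois group `Γ = Gal(ℚ̄_p/ℚ_p)`, with its Krull topology. -/
abbrev GaloisGrp (p : ℕ) [Fact p.Prime] := QpBar p ≃ₐ[ℚ_[p]] QpBar p

noncomputable instance : Algebra ℤ_[p] (QpBar p) :=
  ((algebraMap ℚ_[p] (QpBar p)).comp (PadicInt.Coe.ringHom (p := p))).toAlgebra

/-- Membership in the ring of integers `O_{ℚ̄_p}` (the integral closure of `ℤ_p` in `ℚ̄_p`). -/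
def InIntegers (x : QpBar p) : Prop := IsIntegral ℤ_[p] x

/-- Membership in the maximal ideal `m` of the local ring `O_{ℚ̄_p}`:
integral elements that are not invertible in `O_{ℚ̄_p}`. -/
def InMaxIdeal (x : QpBar p) : Prop :=
  InIntegers p x ∧ ¬ ∃ y : QpBar p, InIntegers p y ∧ x * y = 1

/-- The inertia subgroup `I ⊆ Γ`: those `σ` with `σ(x) − x ∈ m` for all `x ∈ O_{ℚ̄_p}`. -/
def inertia : Set (GaloisGrp p) :=
  {σ | ∀ x : QpBar p, InIntegers p x → InMaxIdeal p (σ x - x)}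

/-- A two-dimensional representation over `E` is absolutely irreducible if after base change
to the algebraic closure of `E` there is no nonzero proper invariant subspace. -/
def AbsIrred (E : Type*) [Field E] {G : Type*} [Group G]
    (ρ : G →* GL (Fin 2) E) : Prop :=
  ∀ W : Submodule (AlgebraicClosure E) (Fin 2 → AlgebraicClosure E),
    (∀ g : G, ∀ w ∈ W,
      (((ρ g : Matrix (Fin 2) (Fin 2) E).map
        (algebraMap E (AlgebraicClosure E))).mulVecLin w) ∈ W) →
    W = ⊥ ∨ W = ⊤

open scoped Pointwise in
/-- Let a profinite group `G` act on `B` with invariants `A`, and let `Q` be a `G`-stable maximal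
ideal of `B` with finite residue field downstairs. Then the inertia group together with a
Frobenius element topologically generates `G`. -/
theorem exists_forall_isClosed_inertia_le_eq_top {A B : Type*} [CommRing A] [CommRing B]
    [Algebra A B] {G : Type*} [Group G] [MulSemiringAction G B] [SMulCommClass G A B]
    [TopologicalSpace G] [CompactSpace G] [TotallyDisconnectedSpace G] [IsTopologicalGroup G]
    [TopologicalSpace B] [DiscreteTopology B] [ContinuousSMul G B] [Algebra.IsInvariant A B G]
    (P : Ideal A) (Q : Ideal B) [P.IsMaximal] [Q.IsMaximal] [Q.LiesOver P] [Finite (A ⧸ P)]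
    (hQ : ∀ g : G, g • Q = Q) :
    ∃ φ : G, ∀ H : Subgroup G, IsClosed (H : Set G) → φ ∈ H →
      (∀ g : G, (∀ x : B, g • x - x ∈ Q) → g ∈ H) → H = ⊤ := by
  let : Field (A ⧸ P) := Ideal.Quotient.field P
  let : Field (B ⧸ Q) := Ideal.Quotient.field Q
  let : Fintype (A ⧸ P) := Fintype.ofFinite _
  have : Algebra.IsIntegral A B := Algebra.IsInvariant.isIntegral_of_profinite (G := G)
  have : Algebra.IsIntegral (A ⧸ P) (B ⧸ Q) := Ideal.Quotient.algebra_isIntegral_of_liesOver Q P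
  have : Algebra.IsAlgebraic (A ⧸ P) (B ⧸ Q) := this.isAlgebraic
  obtain ⟨⟨φ, hφ⟩, hφ'⟩ := Ideal.Quotient.stabilizerHom_surjective_of_profinite (G := G) P Q
    (FiniteField.frobeniusAlgEquivOfAlgebraic (A ⧸ P) (B ⧸ Q))
  have frob : ∀ x : B, Ideal.Quotient.mk Q (φ • x) =
      Ideal.Quotient.mk Q x ^ Fintype.card (A ⧸ P) := fun x =>
    DFunLike.congr_fun hφ' (Ideal.Quotient.mk Q x)
  have frob_pow : ∀ (n : ℕ) (x : B), Ideal.Quotient.mk Q (φ ^ n • x) =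
      Ideal.Quotient.mk Q x ^ Fintype.card (A ⧸ P) ^ n := by
    intro n
    induction n with
    | zero => simp
    | succ n ih => intro x; rw [pow_succ, mul_smul, ih, frob, ← pow_mul, ← pow_succ']
  have approx : ∀ (g : G) (S : Finset B), ∃ n : ℕ, ∀ x ∈ S, φ ^ n • x - g • x ∈ Q := by
    classical
    intro g S
    let F := IntermediateField.adjoin (A ⧸ P) ((S.image (Ideal.Quotient.mk Q) : Finset _) :
      Set (B ⧸ Q))
    have : FiniteDimensional (A ⧸ P) F := IntermediateField.finiteDimensional_adjoin
      fun x _ => Algebra.IsIntegral.isIntegral x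
    have : Finite F := Module.finite_of_finite (A ⧸ P)
    let τ : Gal((B ⧸ Q)/(A ⧸ P)) := Ideal.Quotient.stabilizerHom Q P G ⟨g, hQ g⟩
    obtain ⟨n, hn⟩ := (FiniteField.bijective_frobeniusAlgEquivOfAlgebraic_pow (A ⧸ P) F).2
      (τ.restrictNormal F)
    refine ⟨n, fun x hx => ?_⟩
    rw [← Ideal.Quotient.eq, frob_pow]
    have hxF : Ideal.Quotient.mk Q x ∈ F :=
      IntermediateField.subset_adjoin _ _ (by simpa using ⟨x, hx, rfl⟩)
    have h1 := AlgEquiv.restrictNormal_commutes τ F ⟨_, hxF⟩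
    rw [← hn] at h1
    simp only [AlgEquiv.coe_pow, FiniteField.coe_frobeniusAlgEquivOfAlgebraic_iterate] at h1
    exact h1
  refine ⟨φ, fun H hH hφH hI => eq_top_iff.mpr fun g _ => ?_⟩
  have hcl : ∀ x : B, IsClosed {h : G | h • x - g • x ∈ Q} := fun x =>
    (isClosed_discrete {y : B | y - g • x ∈ Q}).preimage (continuous_id.smul continuous_const)
  obtain ⟨h, hh, hh'⟩ := hH.isCompact.inter_iInter_nonempty _ hcl fun S => by
    obtain ⟨n, hn⟩ := approx g S
    exact ⟨φ ^ n, pow_mem hφH n, by simpa using hn⟩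
  simp only [Set.mem_iInter, Set.mem_ofPred_eq] at hh'
  have : h⁻¹ * g ∈ H := hI _ fun x => by
    have := Ideal.smul_mem_pointwise_smul h⁻¹ _ Q (Q.neg_mem (hh' x))
    rw [hQ] at this
    simpa [smul_sub, mul_smul] using this
  simpa using H.mul_mem hh this

section PadicIntegers

variable {p}

theorem Padic.isIntegralElem_iff_spectralNorm_le_one {L : Type*} [Field L] [Algebra ℚ_[p] L]
    [Algebra.IsAlgebraic ℚ_[p] L] {x : L} :
    ((algebraMap ℚ_[p] L).comp (algebraMap ℤ_[p] ℚ_[p])).IsIntegralElem x ↔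
      spectralNorm ℚ_[p] L x ≤ 1 := by
  let : Algebra ℤ_[p] L := ((algebraMap ℚ_[p] L).comp (algebraMap ℤ_[p] ℚ_[p])).toAlgebra
  have : IsScalarTower ℤ_[p] ℚ_[p] L := .of_algebraMap_eq fun _ => rfl
  have hint : IsIntegral ℚ_[p] x := Algebra.IsIntegral.isIntegral x
  have hiff : spectralNorm ℚ_[p] L x ≤ 1 ↔ ∀ n, ‖(minpoly ℚ_[p] x).coeff n‖ ≤ 1 :=
    spectralValue_le_one_iff (minpoly.monic hint)
  rw [hiff]
  constructor
  · intro h n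
    rw [minpoly.isIntegrallyClosed_eq_field_fractions' (R := ℤ_[p]) ℚ_[p] h,
      Polynomial.coeff_map]
    exact PadicInt.norm_le_one _
  · intro h
    have hlift : minpoly ℚ_[p] x ∈ Polynomial.lifts (algebraMap ℤ_[p] ℚ_[p]) :=
      (Polynomial.lifts_iff_coeff_lifts _).mpr fun n => ⟨⟨_, h n⟩, rfl⟩
    obtain ⟨f, hf, -, hmonic⟩ :=
      Polynomial.lifts_and_degree_eq_and_monic hlift (minpoly.monic hint)
    refine ⟨f, hmonic, ?_⟩
    have := minpoly.aeval ℚ_[p] x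
    rwa [← hf, Polynomial.aeval_map_algebraMap] at this

theorem inIntegers_iff_norm_le_one {x : QpBar p} : InIntegers p x ↔ ‖x‖ ≤ 1 :=
  Padic.isIntegralElem_iff_spectralNorm_le_one

theorem norm_galois_apply (σ : GaloisGrp p) (x : QpBar p) : ‖σ x‖ = ‖x‖ :=
  (spectralNorm_eq_of_equiv σ x).symm

theorem inMaxIdeal_iff_norm_lt_one {x : QpBar p} : InMaxIdeal p x ↔ ‖x‖ < 1 := by
  simp only [InMaxIdeal, inIntegers_iff_norm_le_one]
  constructor
  · rintro ⟨h, h'⟩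
    refine lt_of_le_of_ne h fun h1 => h' ⟨x⁻¹, ?_, ?_⟩
    · rw [norm_inv, h1, inv_one]
    · exact mul_inv_cancel₀ (norm_ne_zero_iff.mp (by rw [h1]; exact one_ne_zero))
  · rintro h
    refine ⟨h.le, ?_⟩
    rintro ⟨y, hy, hxy⟩
    have := congrArg norm hxy
    rw [norm_mul, norm_one] at this
    nlinarith [norm_nonneg x, norm_nonneg y]

theorem mem_inertia_iff {σ : GaloisGrp p} :
    σ ∈ inertia p ↔ ∀ x : QpBar p, ‖x‖ ≤ 1 → ‖σ x - x‖ < 1 := by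
  change (∀ _, _ → _) ↔ _
  simp only [inIntegers_iff_norm_le_one, inMaxIdeal_iff_norm_lt_one]

theorem conj_mem_inertia {σ : GaloisGrp p} (hσ : σ ∈ inertia p) (τ : GaloisGrp p) :
    τ * σ * τ⁻¹ ∈ inertia p := by
  rw [mem_inertia_iff] at hσ ⊢
  intro x hx
  have h := hσ (τ⁻¹ x) (by rwa [norm_galois_apply])
  rw [← norm_galois_apply τ, map_sub] at h
  have h1 : τ (τ⁻¹ x) = x := τ.apply_symm_apply x
  rwa [h1] at h

end PadicIntegers

section PadicFrobenius

/-- The closed unit ball of `ℚ̄_p`. -/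
def unitBall : Subring (QpBar p) where
  carrier := {x | ‖x‖ ≤ 1}
  mul_mem' {a b} ha hb := by
    simp only [Set.mem_ofPred_eq, norm_mul] at *
    exact mul_le_one₀ ha (norm_nonneg _) hb
  one_mem' := by simp
  add_mem' {a b} ha hb := (IsUltrametricDist.norm_add_le_max a b).trans (max_le ha hb)
  zero_mem' := by simp
  neg_mem' {a} ha := by simpa using ha

variable {p}

theorem mem_unitBall {x : QpBar p} : x ∈ unitBall p ↔ ‖x‖ ≤ 1 := Iff.rfl

variable (p)

noncomputable instance : Algebra ℤ_[p] (unitBall p) :=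
  (((algebraMap ℚ_[p] (QpBar p)).comp (PadicInt.Coe.ringHom (p := p))).codRestrict (unitBall p)
    fun x => mem_unitBall.mpr <|
      (norm_algebraMap' (QpBar p) (x : ℚ_[p])).trans_le x.norm_le_one).toAlgebra

theorem coe_algebraMap_unitBall (a : ℤ_[p]) :
    ((algebraMap ℤ_[p] (unitBall p) a : unitBall p) : QpBar p) = algebraMap ℚ_[p] (QpBar p) a :=
  rfl

noncomputable instance : MulSemiringAction (GaloisGrp p) (unitBall p) where
  smul σ x := ⟨σ x, mem_unitBall.mpr ((norm_galois_apply σ x.1).trans_le x.2)⟩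
  one_smul _ := rfl
  mul_smul _ _ _ := rfl
  smul_zero σ := Subtype.ext (map_zero σ)
  smul_add σ _ _ := Subtype.ext (map_add σ _ _)
  smul_one σ := Subtype.ext (map_one σ)
  smul_mul σ _ _ := Subtype.ext (map_mul σ _ _)

theorem coe_galois_smul_unitBall (σ : GaloisGrp p) (x : unitBall p) :
    ((σ • x : unitBall p) : QpBar p) = σ x := rfl

instance : SMulCommClass (GaloisGrp p) ℤ_[p] (unitBall p) where
  smul_comm σ a x := Subtype.ext <| by
    simp [Algebra.smul_def, coe_galois_smul_unitBall, coe_algebraMap_unitBall]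

instance : Algebra.IsInvariant ℤ_[p] (unitBall p) (GaloisGrp p) where
  isInvariant x hx := by
    obtain ⟨a, ha⟩ := (InfiniteGalois.mem_range_algebraMap_iff_fixed x.1).mpr
      fun σ : GaloisGrp p => congrArg Subtype.val (hx σ)
    have : ‖a‖ ≤ 1 := by
      have h := mem_unitBall.mp x.2
      rwa [← ha, norm_algebraMap'] at h
    exact ⟨⟨a, this⟩, Subtype.ext ha⟩

/-- The open unit ball of `ℚ̄_p`, as an ideal of the closed unit ball. -/
def openUnitBall : Ideal (unitBall p) where
  carrier := {x | ‖x.1‖ < 1}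
  add_mem' {a b} ha hb := (IsUltrametricDist.norm_add_le_max a.1 b.1).trans_lt (max_lt ha hb)
  zero_mem' := by simp
  smul_mem' c x hx := by
    simp only [Set.mem_ofPred_eq, smul_eq_mul, Subring.coe_mul, norm_mul] at *
    exact (mul_le_of_le_one_left (norm_nonneg _) c.2).trans_lt hx

variable {p} in
theorem mem_openUnitBall {x : unitBall p} : x ∈ openUnitBall p ↔ ‖(x : QpBar p)‖ < 1 := Iff.rfl

instance : (openUnitBall p).IsMaximal := by
  rw [Ideal.isMaximal_iff]
  refine ⟨by simp [mem_openUnitBall], fun J x _ hx hxJ => ?_⟩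
  have h1 : ‖(x : QpBar p)‖ = 1 := le_antisymm x.2 (not_lt.mp hx)
  have h0 : (x : QpBar p) ≠ 0 := norm_ne_zero_iff.mp (by rw [h1]; exact one_ne_zero)
  have : (⟨(x : QpBar p)⁻¹, mem_unitBall.mpr (by rw [norm_inv, h1, inv_one])⟩ : unitBall p) * x
      = 1 := Subtype.ext (inv_mul_cancel₀ h0)
  exact this ▸ J.mul_mem_left _ hxJ

instance : (openUnitBall p).LiesOver (IsLocalRing.maximalIdeal ℤ_[p]) := by
  constructor
  ext a
  rw [Ideal.mem_comap, mem_openUnitBall, coe_algebraMap_unitBall, norm_algebraMap',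
    IsLocalRing.mem_maximalIdeal, PadicInt.mem_nonunits]
  rfl

open scoped Pointwise in
theorem galois_smul_openUnitBall (σ : GaloisGrp p) : σ • openUnitBall p = openUnitBall p := by
  ext x
  rw [Ideal.mem_pointwise_smul_iff_inv_smul_mem, mem_openUnitBall, mem_openUnitBall,
    coe_galois_smul_unitBall, norm_galois_apply]

/-- The absolute Galois group of `ℚ_p` is topologically generated by the inertia group and a
Frobenius element. -/
theorem exists_forall_isClosed_inertia_subset_eq_top :
    ∃ φ : GaloisGrp p, ∀ H : Subgroup (GaloisGrp p), IsClosed (H : Set (GaloisGrp p)) →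
      φ ∈ H → inertia p ⊆ H → H = ⊤ := by
  let : TopologicalSpace (unitBall p) := ⊥
  have : DiscreteTopology (unitBall p) := ⟨rfl⟩
  have : ContinuousSMul (GaloisGrp p) (unitBall p) := by
    refine continuousSMul_iff_stabilizer_isOpen.mpr fun x => ?_
    convert stabilizer_isOpen_of_isIntegral (K := ℚ_[p]) (x : QpBar p) using 1
    ext σ
    exact Subtype.ext_iff
  have : Finite (ℤ_[p] ⧸ IsLocalRing.maximalIdeal ℤ_[p]) :=
    Finite.of_equiv _ (PadicInt.residueField (p := p)).symm.toEquiv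
  obtain ⟨φ, hφ⟩ := exists_forall_isClosed_inertia_le_eq_top (G := GaloisGrp p)
    (IsLocalRing.maximalIdeal ℤ_[p]) (openUnitBall p) (galois_smul_openUnitBall p)
  refine ⟨φ, fun H hH hφH hI => hφ H hH hφH fun σ hσ => hI ?_⟩
  rw [mem_inertia_iff]
  exact fun x hx => hσ ⟨x, hx⟩

end PadicFrobenius

section TwoByTwo

variable {E : Type*} [Field E]

/-- A matrix whose kernel is stable under an absolutely irreducible representation is zero or
invertible. -/
theorem AbsIrred.eq_zero_or_det_ne_zero {G : Type*} [Group G] {ρ : G →* GL (Fin 2) E}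
    (hρ : AbsIrred E ρ) (M : Matrix (Fin 2) (Fin 2) (AlgebraicClosure E))
    (hM : ∀ g, ∃ A, M * (ρ g : Matrix (Fin 2) (Fin 2) E).map
      (algebraMap E (AlgebraicClosure E)) = A * M) :
    M = 0 ∨ M.det ≠ 0 := by
  rcases hρ (LinearMap.ker M.mulVecLin) (fun g w hw => by
    obtain ⟨A, hA⟩ := hM g
    rw [LinearMap.mem_ker, mulVecLin_apply] at hw ⊢
    rw [mulVecLin_apply, mulVec_mulVec, hA, ← mulVec_mulVec, hw, mulVec_zero]) with h | h
  · right
    intro hdet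
    obtain ⟨v, hv, hv'⟩ := exists_mulVec_eq_zero_iff.mpr hdet
    have : v ∈ LinearMap.ker M.mulVecLin := by simpa using hv'
    rw [h] at this
    exact hv (by simpa using this)
  · left
    rw [LinearMap.ker_eq_top] at h
    ext i j
    have := congrFun (LinearMap.congr_fun h (Pi.single j 1)) i
    simpa using this

/-- A matrix over the base field whose kernel is stable under an absolutely irreducible
representation is zero or invertible. -/
theorem AbsIrred.eq_zero_or_det_ne_zero_of_base {G : Type*} [Group G] {ρ : G →* GL (Fin 2) E}
    (hρ : AbsIrred E ρ) (M : Matrix (Fin 2) (Fin 2) E)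
    (hM : ∀ g, ∃ A, M * (ρ g : Matrix (Fin 2) (Fin 2) E) = A * M) :
    M = 0 ∨ M.det ≠ 0 := by
  rcases hρ.eq_zero_or_det_ne_zero (M.map (algebraMap E (AlgebraicClosure E))) (fun g => by
    obtain ⟨A, hA⟩ := hM g
    exact ⟨A.map (algebraMap E (AlgebraicClosure E)), by
      rw [← Matrix.map_mul, hA, Matrix.map_mul]⟩) with h | h
  · left
    ext i j
    have := congrFun (congrFun h i) j
    simpa using this
  · right
    intro h0
    apply h
    have := RingHom.map_det (algebraMap E (AlgebraicClosure E)) M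
    rw [h0, map_zero] at this
    exact this.symm

/-- **Schur's lemma** for two-dimensional absolutely irreducible representations. -/
theorem AbsIrred.eq_smul_one_of_commute {G : Type*} [Group G] {ρ : G →* GL (Fin 2) E}
    (hρ : AbsIrred E ρ) (M : Matrix (Fin 2) (Fin 2) E)
    (hM : ∀ g, Commute M (ρ g : Matrix (Fin 2) (Fin 2) E)) :
    ∃ c : E, M = c • 1 := by
  set f := algebraMap E (AlgebraicClosure E)
  obtain ⟨l, hl⟩ := Module.End.exists_eigenvalue (Matrix.toLin' (M.map f))
  obtain ⟨v, hv⟩ := hl.exists_hasEigenvector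
  have hv' : (M.map f - l • 1) *ᵥ v = 0 := by
    have := hv.apply_eq_smul
    rw [Matrix.toLin'_apply] at this
    rw [sub_mulVec, this, smul_mulVec, one_mulVec, sub_self]
  rcases hρ.eq_zero_or_det_ne_zero (M.map f - l • 1) (fun g =>
    ⟨(ρ g : Matrix (Fin 2) (Fin 2) E).map f, by
      rw [sub_mul, mul_sub, ← Matrix.map_mul, ← Matrix.map_mul, (hM g).eq]
      simp [f]⟩) with h | h
  · have h00 := congrFun (congrFun h 0) 0
    have h01 := congrFun (congrFun h 0) 1
    have h10 := congrFun (congrFun h 1) 0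
    have h11 := congrFun (congrFun h 1) 1
    simp at h00 h01 h10 h11
    have h1 : M 1 1 = M 0 0 := f.injective (by linear_combination h11 - h00)
    refine ⟨M 0 0, ?_⟩
    ext i j
    fin_cases i <;> fin_cases j <;> simp [h01, h10, h1]
  · exact absurd (exists_mulVec_eq_zero_iff.mp ⟨v, hv.2, hv'⟩) h

/-- The centralizer of a non-scalar `2 × 2` matrix `X` is spanned by `1` and `X`. -/
theorem Matrix.exists_eq_smul_one_add_smul_of_commute {X Y : Matrix (Fin 2) (Fin 2) E}
    (hX : ¬ ∃ c : E, X = c • 1) (h : Commute Y X) :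
    ∃ a b : E, Y = a • 1 + b • X := by
  have h00 := congrFun (congrFun h.eq 0) 0
  have h01 := congrFun (congrFun h.eq 0) 1
  have h10 := congrFun (congrFun h.eq 1) 0
  simp only [mul_apply, Fin.sum_univ_two] at h00 h01 h10
  have key : ∃ b : E, Y 0 1 = b * X 0 1 ∧ Y 1 0 = b * X 1 0 ∧
      Y 0 0 - Y 1 1 = b * (X 0 0 - X 1 1) := by
    by_cases h1 : X 0 1 = 0
    · by_cases h2 : X 1 0 = 0
      · have h3 : X 0 0 - X 1 1 ≠ 0 := by
          intro h3
          refine hX ⟨X 0 0, ?_⟩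
          ext i j
          fin_cases i <;> fin_cases j <;> simp [h1, h2, (sub_eq_zero.mp h3).symm]
        refine ⟨(Y 0 0 - Y 1 1) / (X 0 0 - X 1 1), ?_, ?_, ?_⟩ <;> field_simp
        · linear_combination -h01
        · linear_combination h10
      · refine ⟨Y 1 0 / X 1 0, ?_, ?_, ?_⟩ <;> field_simp
        · linear_combination h00
        · linear_combination -h10
    · refine ⟨Y 0 1 / X 0 1, ?_, ?_, ?_⟩ <;> field_simp
      · linear_combination -h00
      · linear_combination h01
  obtain ⟨b, k1, k2, k3⟩ := key
  refine ⟨Y 0 0 - b * X 0 0, b, ?_⟩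
  ext i j
  fin_cases i <;> fin_cases j <;> simp [k1, k2]
  linear_combination -k3

theorem Matrix.sq_eq_smul_one_of_trace_eq_zero {X : Matrix (Fin 2) (Fin 2) E} (hX : X.trace = 0) :
    X * X = (-X.det) • 1 := by
  rw [trace_fin_two] at hX
  have h1 : X 1 1 = -X 0 0 := by linear_combination hX
  ext i j
  fin_cases i <;> fin_cases j <;> simp [mul_apply, det_fin_two, h1] <;> ring

theorem Matrix.det_smul_one_add_smul_of_trace_eq_zero {X : Matrix (Fin 2) (Fin 2) E}
    (hX : X.trace = 0) (a b : E) :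
    (a • 1 + b • X).det = a ^ 2 + b ^ 2 * X.det := by
  rw [trace_fin_two] at hX
  have h1 : X 1 1 = -X 0 0 := by linear_combination hX
  simp [det_fin_two, h1]
  ring

end TwoByTwo

section Twist

variable {G : Type*} [Group G] {E : Type*} [Field E] {ρ₁ ρ₂ : G →* GL (Fin 2) E} {N : Set G}

theorem Matrix.GeneralLinearGroup.coe_apply_mul_coe_apply_inv {n : Type*} [Fintype n]
    [DecidableEq n] (ρ : G →* GL n E) (g : G) :
    (ρ g : Matrix n n E) * (ρ g⁻¹ : Matrix n n E) = 1 := by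
  rw [← Units.val_mul, ← map_mul, mul_inv_cancel, map_one, Units.val_one]

theorem Matrix.GeneralLinearGroup.coe_apply_inv_mul_coe_apply {n : Type*} [Fintype n]
    [DecidableEq n] (ρ : G →* GL n E) (g : G) :
    (ρ g⁻¹ : Matrix n n E) * (ρ g : Matrix n n E) = 1 := by
  rw [← Units.val_mul, ← map_mul, inv_mul_cancel, map_one, Units.val_one]

open Matrix.GeneralLinearGroup (coe_apply_mul_coe_apply_inv coe_apply_inv_mul_coe_apply)

/-- If a closed subgroup containing `N` and `φ` is everything, then two matrices intertwine
`ρ₁` and `ρ₂` as soon as they do so on `N` and at `φ`. -/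
theorem intertwine_of_isClosed_generating [TopologicalSpace G] [TopologicalSpace E]
    [IsTopologicalRing E] [T2Space E]
    (h₁ : Continuous fun g => (ρ₁ g : Matrix (Fin 2) (Fin 2) E))
    (h₂ : Continuous fun g => (ρ₂ g : Matrix (Fin 2) (Fin 2) E)) {φ : G}
    (hgen : ∀ H : Subgroup G, IsClosed (H : Set G) → φ ∈ H → N ⊆ H → H = ⊤)
    {M : Matrix (Fin 2) (Fin 2) E} (hφ : (ρ₁ φ : Matrix (Fin 2) (Fin 2) E) * M = M * ρ₂ φ)
    (hN : ∀ h ∈ N, (ρ₁ h : Matrix (Fin 2) (Fin 2) E) * M = M * ρ₂ h) (g : G) :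
    (ρ₁ g : Matrix (Fin 2) (Fin 2) E) * M = M * ρ₂ g := by
  let H : Subgroup G :=
    { carrier := {g | (ρ₁ g : Matrix (Fin 2) (Fin 2) E) * M = M * ρ₂ g}
      mul_mem' := fun {a b} ha hb => by
        simp only [Set.mem_ofPred_eq, map_mul, Units.val_mul] at *
        rw [mul_assoc, hb, ← mul_assoc, ha, mul_assoc]
      one_mem' := by simp
      inv_mem' := fun {a} ha => by
        simp only [Set.mem_ofPred_eq] at *
        calc (ρ₁ a⁻¹ : Matrix (Fin 2) (Fin 2) E) * M
            = ρ₁ a⁻¹ * (M * ρ₂ a) * ρ₂ a⁻¹ := by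
              rw [mul_assoc, mul_assoc M, coe_apply_mul_coe_apply_inv, mul_one]
          _ = M * ρ₂ a⁻¹ := by
              rw [← ha, ← mul_assoc, coe_apply_inv_mul_coe_apply, one_mul] }
  have hH : H = ⊤ := hgen H
    (isClosed_eq (h₁.matrix_mul continuous_const) (continuous_const.matrix_mul h₂)) hφ hN
  exact (hH ▸ Subgroup.mem_top g : g ∈ H)

theorem conj_commute_of_normal (hN : ∀ h ∈ N, ∀ g : G, g * h * g⁻¹ ∈ N)
    (hres : ∀ h ∈ N, ρ₁ h = ρ₂ h) {M : Matrix (Fin 2) (Fin 2) E}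
    (hM : ∀ h ∈ N, Commute M (ρ₂ h : Matrix (Fin 2) (Fin 2) E)) (g : G) :
    ∀ h ∈ N, Commute ((ρ₁ g : Matrix (Fin 2) (Fin 2) E) * M * ρ₂ g⁻¹)
      (ρ₂ h : Matrix (Fin 2) (Fin 2) E) := by
  intro h hh
  have hk : g⁻¹ * h * g ∈ N := by simpa using hN h hh g⁻¹
  have e2 : (ρ₂ g⁻¹ : Matrix (Fin 2) (Fin 2) E) * ρ₂ h = ρ₂ (g⁻¹ * h * g) * ρ₂ g⁻¹ := by
    simp only [← Units.val_mul, ← map_mul]; simp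
  have e1 : (ρ₁ g : Matrix (Fin 2) (Fin 2) E) * ρ₂ (g⁻¹ * h * g) = ρ₂ h * ρ₁ g := by
    rw [← hres _ hk, ← hres _ hh]
    simp only [← Units.val_mul, ← map_mul]; simp [mul_assoc]
  change _ * _ = _ * _
  calc (ρ₁ g : Matrix (Fin 2) (Fin 2) E) * M * ρ₂ g⁻¹ * ρ₂ h
      = ρ₁ g * (M * ρ₂ (g⁻¹ * h * g)) * ρ₂ g⁻¹ := by
        rw [mul_assoc, e2]; simp only [mul_assoc]
    _ = (ρ₁ g * ρ₂ (g⁻¹ * h * g)) * M * ρ₂ g⁻¹ := by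
        rw [(hM _ hk).eq]; simp only [mul_assoc]
    _ = _ := by rw [e1]; simp only [mul_assoc]

/-- The case where the common restriction to `N` has only scalar endomorphisms. -/
theorem exists_quadratic_twist_of_scalar_centralizer [TopologicalSpace G] [IsTopologicalGroup G]
    [TopologicalSpace E] [IsTopologicalRing E]
    (h₁ : Continuous fun g => (ρ₁ g : Matrix (Fin 2) (Fin 2) E))
    (h₂ : Continuous fun g => (ρ₂ g : Matrix (Fin 2) (Fin 2) E))
    (hN : ∀ h ∈ N, ∀ g : G, g * h * g⁻¹ ∈ N) (hres : ∀ h ∈ N, ρ₁ h = ρ₂ h)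
    (hdet : ∀ g, (ρ₁ g : Matrix (Fin 2) (Fin 2) E).det = (ρ₂ g : Matrix (Fin 2) (Fin 2) E).det)
    (hscalar : ∀ M : Matrix (Fin 2) (Fin 2) E,
      (∀ h ∈ N, Commute M (ρ₂ h : Matrix (Fin 2) (Fin 2) E)) → ∃ c : E, M = c • 1) :
    ∃ η : G →* Eˣ, Continuous (fun g => (η g : E)) ∧ (∀ h ∈ N, η h = 1) ∧
      (∀ g, η g * η g = 1) ∧
      ∀ g, (ρ₁ g : Matrix (Fin 2) (Fin 2) E) = (η g : E) • (ρ₂ g : Matrix (Fin 2) (Fin 2) E) := by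
  let f : G → E := fun g =>
    ((ρ₁ g : Matrix (Fin 2) (Fin 2) E) * (ρ₂ g⁻¹ : Matrix (Fin 2) (Fin 2) E)) 0 0
  have hf : ∀ g, (ρ₁ g : Matrix (Fin 2) (Fin 2) E) =
      f g • (ρ₂ g : Matrix (Fin 2) (Fin 2) E) := by
    intro g
    obtain ⟨c, hc⟩ := hscalar _
      (conj_commute_of_normal hN hres (fun _ _ => Commute.one_left _) g)
    rw [mul_one] at hc
    have hfg : f g = c := (congrFun (congrFun hc 0) 0).trans (by simp)
    have := congrArg (· * (ρ₂ g : Matrix (Fin 2) (Fin 2) E)) hc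
    simpa [mul_assoc, coe_apply_inv_mul_coe_apply, hfg] using this
  have hinj : ∀ g (a b : E), a • (ρ₂ g : Matrix (Fin 2) (Fin 2) E) = b • (ρ₂ g : Matrix _ _ E) →
      a = b := fun g a b h => smul_left_injective E (Units.ne_zero (ρ₂ g)) h
  have hsq : ∀ g, f g * f g = 1 := by
    intro g
    have h := hdet g
    rw [hf g, det_smul, Fintype.card_fin] at h
    have h0 : (ρ₂ g : Matrix (Fin 2) (Fin 2) E).det ≠ 0 :=
      ((Matrix.isUnit_iff_isUnit_det _).mp (ρ₂ g).isUnit).ne_zero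
    exact mul_right_cancel₀ h0 (by linear_combination h)
  have hN1 : ∀ h ∈ N, f h = 1 := fun h hh => hinj h _ _ (by rw [← hf, hres h hh, one_smul])
  have hmul : ∀ g h, f (g * h) = f g * f h := fun g h => hinj (g * h) _ _ <| by
    rw [← hf, map_mul, map_mul, Units.val_mul, Units.val_mul, hf g, hf h, smul_mul_smul_comm]
  have hone : f 1 = 1 := by simp [f]
  refine ⟨⟨⟨fun g => ⟨f g, f g, hsq g, hsq g⟩, Units.ext hone⟩, fun g h => Units.ext (hmul g h)⟩,
    ?_, fun h hh => Units.ext (hN1 h hh), fun g => Units.ext (hsq g), hf⟩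
  exact (h₁.matrix_mul (h₂.comp continuous_inv)).matrix_elem 0 0

/-- The case where the common restriction to `N` has a non-scalar endomorphism. -/
theorem exists_intertwiner_of_nonscalar_centralizer [TopologicalSpace G]
    [TopologicalSpace E] [IsTopologicalRing E] [T2Space E] (h2 : (2 : E) ≠ 0)
    (h₁ : Continuous fun g => (ρ₁ g : Matrix (Fin 2) (Fin 2) E))
    (h₂ : Continuous fun g => (ρ₂ g : Matrix (Fin 2) (Fin 2) E)) {φ : G}
    (hgen : ∀ H : Subgroup G, IsClosed (H : Set G) → φ ∈ H → N ⊆ H → H = ⊤)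
    (hN : ∀ h ∈ N, ∀ g : G, g * h * g⁻¹ ∈ N) (hres : ∀ h ∈ N, ρ₁ h = ρ₂ h)
    (hirr : AbsIrred E ρ₂)
    (hdet : ∀ g, (ρ₁ g : Matrix (Fin 2) (Fin 2) E).det = (ρ₂ g : Matrix (Fin 2) (Fin 2) E).det)
    {M : Matrix (Fin 2) (Fin 2) E} (hM : ∀ h ∈ N, Commute M (ρ₂ h : Matrix (Fin 2) (Fin 2) E))
    (hMs : ¬ ∃ c : E, M = c • 1) :
    ∃ D : GL (Fin 2) E, ∀ g, ρ₁ g = D * ρ₂ g * D⁻¹ := by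
  have schur : ∀ Z : Matrix (Fin 2) (Fin 2) E,
      (∀ h ∈ N, Commute Z (ρ₂ h : Matrix (Fin 2) (Fin 2) E)) →
      Commute Z (ρ₂ φ : Matrix (Fin 2) (Fin 2) E) → ∃ c : E, Z = c • 1 := fun Z hZ hZφ =>
    hirr.eq_smul_one_of_commute Z fun g => Eq.symm <|
      intertwine_of_isClosed_generating h₂ h₂ hgen hZφ.symm.eq (fun h hh => (hZ h hh).symm.eq) g
  have scalar_commute : ∀ {Z W : Matrix (Fin 2) (Fin 2) E}, (∃ c : E, W = c • 1) →
      Commute Z W := by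
    rintro Z W ⟨c, rfl⟩
    exact (Commute.one_right Z).smul_right c
  obtain ⟨h₀, hh₀, hY⟩ : ∃ h ∈ N, ¬ ∃ c : E, (ρ₂ h : Matrix (Fin 2) (Fin 2) E) = c • 1 := by
    by_contra! hall
    have hall' : ∀ h ∈ N, ∃ c : E, (ρ₂ h : Matrix (Fin 2) (Fin 2) E) = c • 1 := by
      simpa using hall
    exact hMs (schur M hM (scalar_commute
      (schur _ (fun h hh => scalar_commute (hall' h hh)) (Commute.refl _))))
  set Y : Matrix (Fin 2) (Fin 2) E := (ρ₂ h₀ : Matrix (Fin 2) (Fin 2) E)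
  let X : Matrix (Fin 2) (Fin 2) E := Y - (Y.trace / 2) • 1
  have hYX : Y = (Y.trace / 2) • 1 + X := by simp [X]
  have hXtr : X.trace = 0 := by
    simp [X, trace_sub, trace_smul, trace_one]
    field_simp
    ring
  have hXs : ¬ ∃ c : E, X = c • 1 := by
    rintro ⟨c, hc⟩
    exact hY ⟨Y.trace / 2 + c, by rw [add_smul, ← hc]; exact hYX⟩
  have hspan : ∀ Z : Matrix (Fin 2) (Fin 2) E,
      (∀ h ∈ N, Commute Z (ρ₂ h : Matrix (Fin 2) (Fin 2) E)) → ∃ a b : E, Z = a • 1 + b • X :=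
    fun Z hZ => Matrix.exists_eq_smul_one_add_smul_of_commute hXs
      ((hZ h₀ hh₀).sub_right (scalar_commute ⟨_, rfl⟩))
  have hXN : ∀ h ∈ N, Commute X (ρ₂ h : Matrix (Fin 2) (Fin 2) E) := by
    obtain ⟨a, b, hab⟩ := hspan M hM
    have hb : b ≠ 0 := by
      rintro rfl
      exact hMs ⟨a, by simpa using hab⟩
    have hX : X = b⁻¹ • (M - a • 1) := by
      rw [hab, add_sub_cancel_left, smul_smul, inv_mul_cancel₀ hb, one_smul]
    intro h hh
    rw [hX]
    exact ((hM h hh).sub_left (scalar_commute ⟨_, rfl⟩).symm).smul_left _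
  have hconj : ∀ g, ∃ u : E, (ρ₂ g : Matrix (Fin 2) (Fin 2) E) * X = u • (X * ρ₂ g) := by
    intro g
    obtain ⟨a, u, hu⟩ := hspan _ (conj_commute_of_normal hN (fun _ _ => rfl) hXN g)
    have ha : a = 0 := by
      have := congrArg trace hu
      rw [trace_mul_comm, ← mul_assoc, coe_apply_inv_mul_coe_apply, one_mul, hXtr, trace_add,
        trace_smul, trace_smul, hXtr, trace_one, Fintype.card_fin] at this
      simpa [h2] using this.symm
    refine ⟨u, ?_⟩
    have := congrArg (· * (ρ₂ g : Matrix (Fin 2) (Fin 2) E)) hu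
    simpa [mul_assoc, coe_apply_inv_mul_coe_apply, ha] using this
  have hX0 : X ≠ 0 := fun h => hXs ⟨0, by simpa using h⟩
  have hXdet : X.det ≠ 0 := by
    refine (hirr.eq_zero_or_det_ne_zero_of_base X fun g => ?_).resolve_left hX0
    obtain ⟨u, hu⟩ := hconj g⁻¹
    refine ⟨u • (ρ₂ g : Matrix (Fin 2) (Fin 2) E), ?_⟩
    calc X * ρ₂ g = ρ₂ g * (ρ₂ g⁻¹ * X) * ρ₂ g := by
          rw [← mul_assoc, coe_apply_mul_coe_apply_inv, one_mul]
      _ = _ := by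
          rw [hu]
          simp only [mul_assoc, smul_mul_assoc, mul_smul_comm, coe_apply_inv_mul_coe_apply,
            mul_one]
  have hsq := Matrix.sq_eq_smul_one_of_trace_eq_zero hXtr
  have hanti : (ρ₂ φ : Matrix (Fin 2) (Fin 2) E) * X = -(X * ρ₂ φ) := by
    obtain ⟨u, hu⟩ := hconj φ
    have hu2 : u ^ 2 = 1 := by
      have e := congrArg det hu
      rw [det_smul, det_mul, det_mul, Fintype.card_fin] at e
      have h0 : (ρ₂ φ : Matrix (Fin 2) (Fin 2) E).det ≠ 0 :=
        ((Matrix.isUnit_iff_isUnit_det _).mp (ρ₂ φ).isUnit).ne_zero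
      exact mul_right_cancel₀ (mul_ne_zero h0 hXdet) (by linear_combination -e)
    rcases sq_eq_one_iff.mp hu2 with rfl | rfl
    · exact absurd (schur X hXN (Eq.symm (by simpa using hu))) hXs
    · simpa using hu
  obtain ⟨a, b, hab⟩ := hspan _
    (conj_commute_of_normal hN hres (fun _ _ => Commute.one_left _) φ)
  rw [mul_one] at hab
  have hP : (ρ₁ φ : Matrix (Fin 2) (Fin 2) E) = (a • 1 + b • X) * ρ₂ φ := by
    rw [← hab, mul_assoc, coe_apply_inv_mul_coe_apply, mul_one]
  have hnorm : a ^ 2 + b ^ 2 * X.det = 1 := by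
    rw [← Matrix.det_smul_one_add_smul_of_trace_eq_zero hXtr, ← hab, det_mul, hdet, ← det_mul,
      coe_apply_mul_coe_apply_inv, det_one]
  obtain ⟨d, hd0, hdN, hdφ⟩ : ∃ d : Matrix (Fin 2) (Fin 2) E, d ≠ 0 ∧
      (∀ h ∈ N, Commute d (ρ₂ h : Matrix (Fin 2) (Fin 2) E)) ∧
      (ρ₁ φ : Matrix (Fin 2) (Fin 2) E) * d = d * ρ₂ φ := by
    by_cases hd : (1 : Matrix (Fin 2) (Fin 2) E) + (a • 1 + b • X) = 0
    · refine ⟨X, hX0, hXN, ?_⟩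
      rw [hP, eq_neg_of_add_eq_zero_right hd, mul_assoc, hanti]
      simp
    · refine ⟨_, hd, fun h hh => (Commute.one_left _).add_left
        ((scalar_commute ⟨_, rfl⟩).symm.add_left ((hXN h hh).smul_left b)), ?_⟩
      have e : (ρ₂ φ : Matrix (Fin 2) (Fin 2) E) * (a • 1 + b • X) =
          (a • 1 - b • X) * ρ₂ φ := by
        rw [mul_add, sub_mul, mul_smul_comm, mul_smul_comm, hanti]
        simp [sub_eq_add_neg]
      have e' : (a • 1 + b • X) * (a • 1 - b • X) = 1 := by
        simp only [add_mul, mul_sub, smul_mul_smul_comm, hsq, one_mul, mul_one, smul_smul]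
        rw [mul_comm b a, add_sub_add_comm, sub_add_sub_cancel, ← sub_smul,
          show a * a - b * b * -X.det = 1 by linear_combination hnorm, one_smul]
      rw [mul_add, mul_one, hP, mul_assoc, e, ← mul_assoc, e', one_mul, add_mul 1, one_mul,
        add_comm]
  have hall := intertwine_of_isClosed_generating h₁ h₂ hgen hdφ
    fun h hh => by rw [hres h hh]; exact (hdN h hh).symm.eq
  have hdet_d := (hirr.eq_zero_or_det_ne_zero_of_base d
    fun g => ⟨_, (hall g).symm⟩).resolve_left hd0
  refine ⟨GeneralLinearGroup.mkOfDetNeZero d hdet_d, fun g => eq_mul_inv_of_mul_eq <|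
    Units.ext <| hall g⟩

end Twist

/-- Let `ρ₁, ρ₂ : Γ → GL₂(E)` be absolutely irreducible continuous
representations with `det ρ₁ = det ρ₂` and `ρ₁|_I ≅ ρ₂|_I`.  Then there is a continuous
character `η : Γ → E^×`, trivial on `I` and with `η² = 1`, such that `ρ₁ ≅ ρ₂ ⊗ η`. -/
theorem statement19 (p : ℕ) [Fact p.Prime]
    (E : Type*) [NormedField E] [NormedAlgebra ℚ_[p] E] [FiniteDimensional ℚ_[p] E]
    (ρ₁ ρ₂ : GaloisGrp p →* GL (Fin 2) E)
    (hcont₁ : ∀ i j, Continuous fun σ => (ρ₁ σ : Matrix (Fin 2) (Fin 2) E) i j)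
    (hcont₂ : ∀ i j, Continuous fun σ => (ρ₂ σ : Matrix (Fin 2) (Fin 2) E) i j)
    (hirr₁ : AbsIrred E ρ₁) (hirr₂ : AbsIrred E ρ₂)
    (hdet : ∀ g, (ρ₁ g : Matrix (Fin 2) (Fin 2) E).det = (ρ₂ g : Matrix (Fin 2) (Fin 2) E).det)
    (hres : ∃ C : GL (Fin 2) E, ∀ σ ∈ inertia p, ρ₁ σ = C * ρ₂ σ * C⁻¹) :
    ∃ η : GaloisGrp p →* Eˣ,
      Continuous (fun σ => ((η σ : Eˣ) : E)) ∧
      (∀ σ ∈ inertia p, η σ = 1) ∧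
      (∀ σ, η σ * η σ = 1) ∧
      ∃ C : GL (Fin 2) E, ∀ g : GaloisGrp p,
        (ρ₁ g : Matrix (Fin 2) (Fin 2) E)
          = (C : Matrix (Fin 2) (Fin 2) E) *
            (((η g : Eˣ) : E) • (ρ₂ g : Matrix (Fin 2) (Fin 2) E)) *
            ((C⁻¹ : GL (Fin 2) E) : Matrix (Fin 2) (Fin 2) E) := by
  obtain ⟨C, hC⟩ := hres
  obtain ⟨φ, hφ⟩ := exists_forall_isClosed_inertia_subset_eq_top p
  have h2 : (2 : E) ≠ 0 := by
    have : CharZero E := charZero_of_injective_algebraMap (algebraMap ℚ_[p] E).injective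
    exact two_ne_zero
  let ρ : GaloisGrp p →* GL (Fin 2) E := (MulAut.conj C⁻¹).toMonoidHom.comp ρ₁
  have hρ : ∀ g, ρ g = C⁻¹ * ρ₁ g * C := fun g => by simp [ρ]
  have hρ₁ : ∀ g, (ρ₁ g : Matrix (Fin 2) (Fin 2) E) =
      C * ρ g * (C⁻¹ : GL (Fin 2) E) := fun g => by
    rw [hρ, ← Units.val_mul, ← Units.val_mul]
    congr 1
    group
  have hρI : ∀ σ ∈ inertia p, ρ σ = ρ₂ σ := fun σ hσ => by
    rw [hρ, hC σ hσ]
    group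
  have hρdet : ∀ g, (ρ g : Matrix (Fin 2) (Fin 2) E).det =
      (ρ₂ g : Matrix (Fin 2) (Fin 2) E).det := fun g => by
    rw [← hdet, hρ₁, det_units_conj]
  have hρcont : Continuous fun g => (ρ g : Matrix (Fin 2) (Fin 2) E) := by
    simp only [hρ, Units.val_mul]
    exact (continuous_const.matrix_mul (continuous_matrix hcont₁)).matrix_mul continuous_const
  have hρ₂cont := continuous_matrix hcont₂
  have hI : ∀ σ ∈ inertia p, ∀ τ : GaloisGrp p, τ * σ * τ⁻¹ ∈ inertia p :=
    fun σ hσ τ => conj_mem_inertia hσ τ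
  by_cases hscalar : ∀ M : Matrix (Fin 2) (Fin 2) E,
      (∀ σ ∈ inertia p, Commute M (ρ₂ σ : Matrix (Fin 2) (Fin 2) E)) → ∃ c : E, M = c • 1
  · obtain ⟨η, hηcont, hηI, hηsq, hη⟩ :=
      exists_quadratic_twist_of_scalar_centralizer hρcont hρ₂cont hI hρI hρdet hscalar
    exact ⟨η, hηcont, hηI, hηsq, C, fun g => by rw [hρ₁, hη]⟩
  · simp only [not_forall] at hscalar
    obtain ⟨M, hM, hMs⟩ := hscalar
    obtain ⟨D, hD⟩ := exists_intertwiner_of_nonscalar_centralizer h2 hρcont hρ₂cont hφ hI hρI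
      hirr₂ hρdet hM hMs
    refine ⟨1, continuous_const, fun _ _ => rfl, fun _ => one_mul 1, C * D, fun g => ?_⟩
    rw [hρ₁, hD, _root_.mul_inv_rev]
    simp [mul_assoc]
end
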